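/- arXiv:1108.3551 — 2 statements merged into one kernel-verified Lean document; each statement's English description precedes it below -/
import Mathlib

section
/- (Division Lemma.) Let m = p + q, let A_1, ..., A_p be pairwise commuting semisimple complex m×m matrices such that the vectors A_1 x, ..., A_p x are linearly independent for x in a dense subset of ℂ^m, and suppose there exist homogeneous polynomials G_1, ..., G_q on ℂ^m with DG_j(x)(A_i x) = 0 for all i, j, x, whose differentials DG_1(x), ..., DG_q(x) are linearly independent for x in a dense subset of ℂ^m (i.e. the linear vector fields Y_i(x) = A_i x together with G_1,...,G_q form a nondegenerate linear integrable system). Let X be a complex analytic vector field on an open neighborhood U of 0 in ℂ^m such that [X, Y_i] = 0 for all i (where Y_i(x) = A_i x) and such that X(x) lies in the linear span of A_1 x, ..., A_p x for every x ∈ U. Then there exist a neighborhood V ⊆ U of 0 and unique analytic functions f_1, ..., f_p on V such that X(x) = Σ_{i=1}^p f_i(x) · A_i x for all x ∈ V, and moreover each f_i is a common first integral of the linear system, i.e. Df_i(x)(A_k x) = 0 for all k and all x ∈ V. -/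
open scoped BigOperators

/-- A complex square matrix is semisimple iff it is diagonalizable (over ℂ). -/
def IsSemisimpleMatrixC {m : ℕ} (A : Matrix (Fin m) (Fin m) ℂ) : Prop :=
  ∃ P : Matrix (Fin m) (Fin m) ℂ, IsUnit P ∧ ∃ d : Fin m → ℂ,
    A = P * Matrix.diagonal d * P⁻¹

section DivisionAux

variable {E : Type*} [NormedAddCommGroup E] [NormedSpace ℂ E]

/-- Divided difference operator on multilinear maps: the sum over `k` of
`M (π y₁, …, π y_k, e, y_{k+1}, …, y_n)`. -/
noncomputable def divOp (e : E) (π : E →L[ℂ] E) :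
    (n : ℕ) → ((E [×(n + 1)]→L[ℂ] ℂ) →L[ℂ] (E [×n]→L[ℂ] ℂ))
  | 0 => (ContinuousLinearMap.apply ℂ (E [×0]→L[ℂ] ℂ) e).comp
      (continuousMultilinearCurryLeftEquiv ℂ (fun _ : Fin 1 => E) ℂ :
        (E [×1]→L[ℂ] ℂ) →L[ℂ] (E →L[ℂ] (E [×0]→L[ℂ] ℂ)))
  | (n + 1) => (ContinuousLinearMap.apply ℂ (E [×(n+1)]→L[ℂ] ℂ) e).comp
      (continuousMultilinearCurryLeftEquiv ℂ (fun _ : Fin (n + 2) => E) ℂ :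
        (E [×(n+2)]→L[ℂ] ℂ) →L[ℂ] (E →L[ℂ] (E [×(n+1)]→L[ℂ] ℂ))) +
      ((continuousMultilinearCurryLeftEquiv ℂ (fun _ : Fin (n + 1) => E) ℂ).symm :
        (E →L[ℂ] (E [×n]→L[ℂ] ℂ)) →L[ℂ] (E [×(n+1)]→L[ℂ] ℂ)).comp
        (((ContinuousLinearMap.compL ℂ E (E [×(n+1)]→L[ℂ] ℂ) (E [×n]→L[ℂ] ℂ)) (divOp e π n)).comp
          (((ContinuousLinearMap.compL ℂ E E (E [×(n+1)]→L[ℂ] ℂ)).flip π).comp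
          (continuousMultilinearCurryLeftEquiv ℂ (fun _ : Fin (n + 2) => E) ℂ :
            (E [×(n+2)]→L[ℂ] ℂ) →L[ℂ] (E →L[ℂ] (E [×(n+1)]→L[ℂ] ℂ)))))

lemma divOp_zero (e : E) (π : E →L[ℂ] E) (M : E [×1]→L[ℂ] ℂ) :
    divOp e π 0 M = M.curryLeft e := rfl

lemma divOp_succ (e : E) (π : E →L[ℂ] E) (n : ℕ) (M : E [×(n+2)]→L[ℂ] ℂ) :
    divOp e π (n + 1) M = M.curryLeft e +
      ContinuousLinearMap.uncurryLeft (Ei := fun _ => E)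
        ((divOp e π n).comp ((M.curryLeft).comp π)) := rfl

lemma norm_divOp_le (e : E) (π : E →L[ℂ] E) (n : ℕ) (M : E [×(n+1)]→L[ℂ] ℂ) :
    ‖divOp e π n M‖ ≤ (‖e‖ + ‖π‖ + 1) ^ (n + 1) * ‖M‖ := by
  induction n with
  | zero =>
    rw [divOp_zero]
    refine (ContinuousLinearMap.le_opNorm _ _).trans ?_
    rw [ContinuousMultilinearMap.curryLeft_norm, mul_comm]
    refine mul_le_mul_of_nonneg_right ?_ (norm_nonneg _)
    simp only [zero_add, pow_one]
    linarith [norm_nonneg π]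
  | succ n ih =>
    rw [divOp_succ]
    have hK : 1 ≤ ‖e‖ + ‖π‖ + 1 := by linarith [norm_nonneg π, norm_nonneg e]
    set K := ‖e‖ + ‖π‖ + 1 with hKdef
    have h1 : ‖M.curryLeft e‖ ≤ ‖M‖ * ‖e‖ := by
      refine (ContinuousLinearMap.le_opNorm _ _).trans ?_
      rw [ContinuousMultilinearMap.curryLeft_norm]
    have h2 : ‖(divOp e π n).comp ((M.curryLeft).comp π)‖ ≤ K ^ (n + 1) * (‖M‖ * ‖π‖) := by
      refine ContinuousLinearMap.opNorm_le_bound _ (by positivity) fun v => ?_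
      refine (ih _).trans ?_
      rw [mul_assoc]
      gcongr
      refine (ContinuousLinearMap.le_opNorm _ _).trans ?_
      gcongr
      refine (ContinuousLinearMap.opNorm_comp_le _ _).trans ?_
      rw [ContinuousMultilinearMap.curryLeft_norm]
    refine (norm_add_le _ _).trans ?_
    rw [ContinuousLinearMap.uncurryLeft_norm]
    have h3 : 1 ≤ K ^ (n + 1) := one_le_pow₀ hK
    calc _ ≤ ‖M‖ * ‖e‖ + K ^ (n + 1) * (‖M‖ * ‖π‖) := add_le_add h1 h2
      _ ≤ K ^ (n + 1) * (‖M‖ * ‖e‖) + K ^ (n + 1) * (‖M‖ * ‖π‖) := by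
        have := le_mul_of_one_le_left (by positivity : 0 ≤ ‖M‖ * ‖e‖) h3
        linarith
      _ = K ^ (n + 1) * (‖e‖ + ‖π‖) * ‖M‖ := by ring
      _ ≤ K ^ (n + 1) * K * ‖M‖ := by
        gcongr
        linarith
      _ = _ := by ring

lemma divOp_identity (e : E) (π : E →L[ℂ] E) (l : E →L[ℂ] ℂ) (hl : ∀ x, x = π x + l x • e)
    (n : ℕ) (M : E [×(n+1)]→L[ℂ] ℂ) (x : E) :
    l x * divOp e π n M (fun _ => x) = M (fun _ => x) - M (fun _ => π x) := by
  have key : ∀ (k : ℕ) (M : E [×(k+1)]→L[ℂ] ℂ) (y : E), M (fun _ => y) =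
      M.curryLeft y (fun _ => y) := by
    intro k M y
    rw [ContinuousMultilinearMap.curryLeft_apply]
    congr 1
    ext i
    refine Fin.cases ?_ (fun j => ?_) i <;> simp
  have hle : l x • e = x - π x := by
    rw [eq_sub_iff_add_eq, add_comm]; exact (hl x).symm
  have step : ∀ (k : ℕ) (M : E [×(k+1)]→L[ℂ] ℂ) (v : Fin k → E), l x * M.curryLeft e v
      = M.curryLeft x v - M.curryLeft (π x) v := by
    intro k M v
    rw [← sub_apply, ← map_sub, ← hle, map_smul]
    simp
  induction n with
  | zero =>
    rw [divOp_zero, step, key _ M, key _ M]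
    congr 2
    ext i
    exact i.elim0
  | succ n ih =>
    rw [divOp_succ, add_apply, mul_add, step,
      ContinuousLinearMap.uncurryLeft_apply, key _ M, key _ M]
    have := ih (M.curryLeft (π x))
    simp only [ContinuousLinearMap.comp_apply]
    change _ + l x * divOp e π n (M.curryLeft (π x)) (fun _ => x) = _
    rw [this]
    ring

/-- Division of an analytic function vanishing on the hyperplane `l = 0`. -/
lemma exists_analytic_div (e : E) (π : E →L[ℂ] E) (l : E →L[ℂ] ℂ)
    (hl : ∀ x, x = π x + l x • e) (h : E → ℂ) (hh : AnalyticAt ℂ h 0)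
    (hz : ∀ᶠ x in nhds (0 : E), h (π x) = 0) :
    ∃ g : E → ℂ, AnalyticAt ℂ g 0 ∧ ∀ᶠ x in nhds (0 : E), h x = l x * g x := by
  obtain ⟨P, R, hP⟩ := hh
  set Q : FormalMultilinearSeries ℂ E ℂ := fun n => divOp e π n (P (n + 1)) with hQ
  set K := ‖e‖ + ‖π‖ + 1 with hK
  have hK0 : 0 < K := by positivity
  obtain ⟨r, hr0, hr⟩ : ∃ r : NNReal, 0 < r ∧ (r : ENNReal) < P.radius := by
    obtain ⟨r, h1, h2⟩ := ENNReal.lt_iff_exists_nnreal_btwn.1 (hP.r_pos.trans_le hP.r_le)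
    exact ⟨r, by exact_mod_cast h1, h2⟩
  obtain ⟨C, hC, hb⟩ := P.norm_mul_pow_le_of_lt_radius hr
  have hrr : (0 : ℝ) < r := hr0
  have hQr : 0 < Q.radius := by
    have hs : (0 : ℝ) < r / K := by positivity
    have := Q.le_radius_of_bound (r := Real.toNNReal (r / K)) (C * K / r) (fun n => by
      have h1 := norm_divOp_le e π n (P (n + 1))
      rw [← hK] at h1
      have h2 := hb (n + 1)
      rw [Real.coe_toNNReal _ hs.le]
      change ‖divOp e π n (P (n + 1))‖ * ((r : ℝ) / K) ^ n ≤ _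
      calc _ ≤ K ^ (n + 1) * ‖P (n + 1)‖ * ((r : ℝ) / K) ^ n := by gcongr
        _ = (‖P (n + 1)‖ * (r : ℝ) ^ (n + 1)) * K / r := by
          rw [div_pow]
          field_simp
          ring
        _ ≤ _ := by gcongr)
    refine lt_of_lt_of_le ?_ this
    rw [ENNReal.coe_pos]
    exact Real.toNNReal_pos.2 hs
  have hQs := Q.hasFPowerSeriesOnBall hQr
  refine ⟨Q.sum, hQs.analyticAt, ?_⟩
  have e1 : ∀ᶠ x in nhds (0 : E), x ∈ Metric.eball (0 : E) R := Metric.eball_mem_nhds _ hP.r_pos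
  have e2 : ∀ᶠ x in nhds (0 : E), π x ∈ Metric.eball (0 : E) R := by
    have : Filter.Tendsto π (nhds 0) (nhds 0) := by
      simpa using π.continuous.tendsto 0
    exact this.eventually e1
  have e3 : ∀ᶠ x in nhds (0 : E), x ∈ Metric.eball (0 : E) Q.radius := Metric.eball_mem_nhds _ hQr
  filter_upwards [hz, e1, e2, e3] with x h0 h1 h2 h3
  have s1 := hP.hasSum h1
  have s2 := hP.hasSum h2
  have s3 := (hQs.hasSum h3).mul_left (l x)
  rw [zero_add] at s1 s2 s3
  have s4 := s1.sub s2
  rw [h0, sub_zero] at s4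
  rw [← hasSum_nat_add_iff' 1] at s4
  have z : (P 0 fun _ => x) = (P 0 fun _ => π x) := by
    congr 1
    ext i
    exact i.elim0
  simp only [Finset.range_one, Finset.sum_singleton, z, sub_self, sub_zero] at s4
  have heq : (fun n => l x * (Q n fun _ => x))
      = fun n => (P (n + 1) fun _ => x) - (P (n + 1) fun _ => π x) :=
    funext fun n => divOp_identity e π l hl n (P (n + 1)) x
  rw [heq] at s3
  exact s4.unique s3

end DivisionAux

/-- Two functions continuous on an open set and equal on a dense set are equal there. -/
lemma eqOn_of_dense {E F : Type*} [TopologicalSpace E] [TopologicalSpace F] [T2Space F]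
    {V S : Set E} (hV : IsOpen V) (hS : Dense S) {f g : E → F} (hf : ContinuousOn f V)
    (hg : ContinuousOn g V) (h : ∀ x ∈ V, x ∈ S → f x = g x) : ∀ x ∈ V, f x = g x := by
  have : Set.EqOn f g (V ∩ S) := fun x hx => h x hx.1 hx.2
  exact this.of_subset_closure hf hg Set.inter_subset_left (hS.open_subset_closure_inter hV)

lemma diag_aux {m : ℕ} {A P : Matrix (Fin m) (Fin m) ℂ} (hP : IsUnit P) {d : Fin m → ℂ}
    (h : A = P * Matrix.diagonal d * P⁻¹) (z : Fin m → ℂ) (j : Fin m) :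
    (P⁻¹.mulVec (A.mulVec z)) j = d j * (P⁻¹.mulVec z) j := by
  have hPd : IsUnit P.det := (Matrix.isUnit_iff_isUnit_det P).1 hP
  rw [Matrix.mulVec_mulVec, h, ← Matrix.mul_assoc, ← Matrix.mul_assoc,
    Matrix.nonsing_inv_mul _ hPd, Matrix.one_mul, ← Matrix.mulVec_mulVec, Matrix.mulVec_diagonal]

lemma ss_maxGen {m : ℕ} {A : Matrix (Fin m) (Fin m) ℂ} (hA : IsSemisimpleMatrixC A) (μ : ℂ) :
    Module.End.maxGenEigenspace (Matrix.toLin' A) μ ≤ Module.End.eigenspace (Matrix.toLin' A) μ := by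
  obtain ⟨P, hP, d, h⟩ := hA
  have hPd : IsUnit P.det := (Matrix.isUnit_iff_isUnit_det P).1 hP
  have inj : ∀ y : Fin m → ℂ, P⁻¹.mulVec y = 0 → y = 0 := by
    intro y hy
    have := congrArg P.mulVec hy
    rwa [Matrix.mulVec_mulVec, Matrix.mul_nonsing_inv _ hPd, Matrix.one_mulVec,
      Matrix.mulVec_zero] at this
  have h1 : ∀ (z : Fin m → ℂ) (j : Fin m),
      (P⁻¹.mulVec ((Matrix.toLin' A - algebraMap ℂ (Module.End ℂ (Fin m → ℂ)) μ) z)) j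
        = (d j - μ) * (P⁻¹.mulVec z) j := by
    intro z j
    have := diag_aux hP h z j
    simp only [LinearMap.sub_apply, Matrix.toLin'_apply, Module.algebraMap_end_apply,
      Matrix.mulVec_sub, Matrix.mulVec_smul, Pi.sub_apply, Pi.smul_apply, smul_eq_mul, this]
    ring
  have h2 : ∀ (k : ℕ) (z : Fin m → ℂ) (j : Fin m),
      (P⁻¹.mulVec (((Matrix.toLin' A - algebraMap ℂ (Module.End ℂ (Fin m → ℂ)) μ) ^ k) z)) j
        = (d j - μ) ^ k * (P⁻¹.mulVec z) j := by
    intro k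
    induction k with
    | zero => intro z j; simp
    | succ k ih =>
      intro z j
      rw [pow_succ, Module.End.mul_apply, ih, h1]
      ring
  intro x hx
  rw [Module.End.mem_maxGenEigenspace] at hx
  obtain ⟨k, hk⟩ := hx
  rw [Module.End.mem_eigenspace_iff, ← sub_eq_zero]
  have : (Matrix.toLin' A) x - μ • x
      = (Matrix.toLin' A - algebraMap ℂ (Module.End ℂ (Fin m → ℂ)) μ) x := by simp
  rw [this]
  apply inj
  ext j
  rw [h1]
  have h3 := h2 k x j
  have hk' : ((Matrix.toLin' A - algebraMap ℂ (Module.End ℂ (Fin m → ℂ)) μ) ^ k) x = 0 := by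
    rw [← hk, Module.End.one_eq_id]
    rfl
  rw [hk', Matrix.mulVec_zero, Pi.zero_apply] at h3
  rcases mul_eq_zero.1 h3.symm with h4 | h4
  · rw [eq_zero_of_pow_eq_zero h4]; simp
  · rw [h4]; simp

lemma ss_iSup {m : ℕ} (A : Matrix (Fin m) (Fin m) ℂ) :
    ⨆ μ, Module.End.maxGenEigenspace (Matrix.toLin' A) μ = ⊤ := by
  exact Module.End.iSup_maxGenEigenspace_eq_top _

lemma exists_joint_basis {p m : ℕ} (A : Fin p → Matrix (Fin m) (Fin m) ℂ)
    (hAcomm : ∀ i j, A i * A j = A j * A i)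
    (hss : ∀ i, IsSemisimpleMatrixC (A i)) :
    ∃ (b : Module.Basis (Fin m) ℂ (Fin m → ℂ)) (lam : Fin p → Fin m → ℂ),
      ∀ i j, (A i).mulVec (b j) = lam i j • b j := by
  have htop := Module.End.iSup_iInf_maxGenEigenspace_eq_top_of_iSup_maxGenEigenspace_eq_top_of_commute
    (fun i => Matrix.toLin' (A i))
    (fun i j _ => by
      change _ * _ = _ * _
      rw [Module.End.mul_eq_comp, Module.End.mul_eq_comp, ← Matrix.toLin'_mul, hAcomm,
        Matrix.toLin'_mul])
    (fun i => ss_iSup (A i))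
  set s : Set (Fin m → ℂ) := {v | ∃ χ : Fin p → ℂ, ∀ i, (A i).mulVec v = χ i • v} with hs
  have hspan : ⊤ ≤ Submodule.span ℂ s := by
    rw [← htop]
    refine iSup_le fun χ v hv => Submodule.subset_span ⟨χ, fun i => ?_⟩
    have := ss_maxGen (hss i) (χ i) ((Submodule.mem_iInf _).1 hv i)
    rw [Module.End.mem_eigenspace_iff] at this
    simpa using this
  have b0 := Module.Basis.ofSpan hspan
  obtain ⟨ι, b0, hb0⟩ : ∃ (ι : Type) (b : Module.Basis ι ℂ (Fin m → ℂ)), ∀ i, b i ∈ s :=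
    ⟨_, Module.Basis.ofSpan hspan, fun i =>
      Module.Basis.ofSpan_subset hspan ⟨i, rfl⟩⟩
  have : Fintype ι := FiniteDimensional.fintypeBasisIndex b0
  have hcard : Fintype.card ι = m := by
    rw [← Module.finrank_eq_card_basis b0]; simp
  let e : ι ≃ Fin m := Fintype.equivFinOfCardEq hcard
  choose χ hχ using hb0
  refine ⟨b0.reindex e, fun i j => χ (e.symm j) i, fun i j => ?_⟩
  rw [Module.Basis.reindex_apply]
  exact hχ _ i

/-- Division lemma: an analytic vector field commuting with a nondegenerate linear
integrable system and tangent to it can be written uniquely as a combination of the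
linear vector fields with first-integral coefficients. -/
theorem division_lemma
    (p q m : ℕ) (hm : m = p + q)
    (A : Fin p → Matrix (Fin m) (Fin m) ℂ)
    (hAcomm : ∀ i j, A i * A j = A j * A i)
    (hss : ∀ i, IsSemisimpleMatrixC (A i))
    (hAind : Dense {x : Fin m → ℂ | LinearIndependent ℂ fun i => (A i).mulVec x})
    -- homogeneous polynomial first integrals G_1, ..., G_q
    (G : Fin q → MvPolynomial (Fin m) ℂ) (d : Fin q → ℕ)
    (hGhom : ∀ j, (G j).IsHomogeneous (d j))
    (hGint : ∀ i j, ∀ x : Fin m → ℂ,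
      fderiv ℂ (fun y => MvPolynomial.eval y (G j)) x ((A i).mulVec x) = 0)
    (hGind : Dense {x : Fin m → ℂ |
      LinearIndependent ℂ fun j => fderiv ℂ (fun y => MvPolynomial.eval y (G j)) x})
    -- the vector field X
    (U : Set (Fin m → ℂ)) (hUopen : IsOpen U) (hU0 : (0 : Fin m → ℂ) ∈ U)
    (X : (Fin m → ℂ) → (Fin m → ℂ))
    (hXan : AnalyticOnNhd ℂ X U)
    -- X commutes with each linear vector field Y_i(x) = A_i x
    (hcomm : ∀ i, ∀ x ∈ U, (A i).mulVec (X x) - fderiv ℂ X x ((A i).mulVec x) = 0)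
    -- X(x) lies in the span of the A_i x
    (hspan : ∀ x ∈ U, X x ∈ Submodule.span ℂ (Set.range fun i => (A i).mulVec x)) :
    ∃ V : Set (Fin m → ℂ), IsOpen V ∧ V ⊆ U ∧ (0 : Fin m → ℂ) ∈ V ∧
      ∃ f : Fin p → (Fin m → ℂ) → ℂ,
        (∀ i, AnalyticOnNhd ℂ (f i) V) ∧
        (∀ x ∈ V, X x = ∑ i, f i x • (A i).mulVec x) ∧
        -- uniqueness of the coefficients
        (∀ g : Fin p → (Fin m → ℂ) → ℂ, (∀ i, AnalyticOnNhd ℂ (g i) V) →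
          (∀ x ∈ V, X x = ∑ i, g i x • (A i).mulVec x) →
          ∀ i, ∀ x ∈ V, g i x = f i x) ∧
        -- each f_i is a common first integral of the linear system
        (∀ i l, ∀ x ∈ V, fderiv ℂ (f i) x ((A l).mulVec x) = 0) := by
  classical
  obtain ⟨b, lam, hb⟩ := exists_joint_basis A hAcomm hss
  -- coordinate functionals as continuous linear maps
  let l : Fin m → ((Fin m → ℂ) →L[ℂ] ℂ) := fun j => LinearMap.toContinuousLinearMap (b.coord j)
  have hl : ∀ j x, l j x = b.repr x j := fun j x => rfl
  have hlA : ∀ i j x, l j ((A i).mulVec x) = lam i j * l j x := by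
    intro i j x
    have h1 : (A i).mulVec x = ∑ k, (b.repr x k * lam i k) • b k := by
      conv_lhs => rw [← b.sum_repr x, Matrix.mulVec_sum]
      refine Finset.sum_congr rfl fun k _ => ?_
      rw [Matrix.mulVec_smul, hb, smul_smul]
    rw [h1, hl, hl, b.repr_sum_self, mul_comm]
  -- independence of the weights
  let Lam : (Fin p → ℂ) →ₗ[ℂ] (Fin m → ℂ) :=
    { toFun := fun c j => ∑ i, c i * lam i j
      map_add' := fun c c' => by
        ext j
        simp [add_mul, Finset.sum_add_distrib]
      map_smul' := fun a c => by
        ext j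
        simp [Finset.mul_sum, mul_assoc] }
  have hLamdef : ∀ c j, Lam c j = ∑ i, c i * lam i j := fun c j => rfl
  have hcoord : ∀ (c : Fin p → ℂ) x j, l j (∑ i, c i • (A i).mulVec x) = Lam c j * l j x := by
    intro c x j
    rw [map_sum, hLamdef, Finset.sum_mul]
    refine Finset.sum_congr rfl fun i _ => ?_
    rw [map_smul, hlA, smul_eq_mul, mul_assoc]
  have hext : ∀ x y : Fin m → ℂ, (∀ j, l j x = l j y) → x = y := by
    intro x y h
    exact b.repr.injective (Finsupp.ext h)
  have hker : LinearMap.ker Lam = ⊥ := by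
    rw [LinearMap.ker_eq_bot']
    intro c hc
    obtain ⟨x, hx⟩ := hAind.nonempty
    have h0 : ∑ i, c i • (A i).mulVec x = 0 := by
      apply hext
      intro j
      rw [hcoord, hc, map_zero]
      simp
    funext i
    exact Fintype.linearIndependent_iff.1 hx c h0 i
  obtain ⟨B, hB⟩ := LinearMap.exists_leftInverse_of_injective Lam hker
  have hBL : ∀ c, B (Lam c) = c := fun c => LinearMap.congr_fun hB c
  have hrep : ∀ x ∈ U, ∃ c : Fin p → ℂ, X x = ∑ i, c i • (A i).mulVec x := by
    intro x hx
    obtain ⟨c, hc⟩ := (Submodule.mem_span_range_iff_exists_fun ℂ).1 (hspan x hx)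
    exact ⟨c, hc.symm⟩
  -- division of the coordinates
  have hdiv : ∀ j, ∃ g : (Fin m → ℂ) → ℂ, AnalyticAt ℂ g 0 ∧
      ∀ᶠ x in nhds (0 : Fin m → ℂ), l j (X x) = l j x * g x := by
    intro j
    let π : (Fin m → ℂ) →L[ℂ] (Fin m → ℂ) :=
      ContinuousLinearMap.id ℂ _ - (l j).smulRight (b j)
    have hπ : ∀ x, π x = x - l j x • b j := fun x => rfl
    refine exists_analytic_div (b j) π (l j) (fun x => by rw [hπ]; abel) (fun x => l j (X x)) ?_ ?_
    · exact ((l j).analyticAt _).comp (hXan 0 hU0)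
    · have h1 : Filter.Tendsto π (nhds 0) (nhds 0) := by
        simpa using π.continuous.tendsto 0
      filter_upwards [h1.eventually (hUopen.mem_nhds hU0)] with x hx
      obtain ⟨c, hc⟩ := hrep _ hx
      have : l j (π x) = 0 := by
        rw [hπ, map_sub, map_smul, hl j (b j)]
        simp
      rw [hc, hcoord, this, mul_zero]
  choose g hgan hg using hdiv
  -- the neighborhood
  have hev : ∀ᶠ x in nhds (0 : Fin m → ℂ), x ∈ U ∧ ∀ j, AnalyticAt ℂ (g j) x ∧
      l j (X x) = l j x * g j x := by
    refine Filter.Eventually.and (hUopen.mem_nhds hU0) ?_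
    rw [Filter.eventually_all]
    intro j
    exact (hgan j).eventually_analyticAt.and (hg j)
  obtain ⟨V, hVsub, hVopen, hV0⟩ := eventually_nhds_iff.1 hev
  have hVU : V ⊆ U := fun x hx => (hVsub x hx).1
  -- density of the complement of coordinate hyperplanes
  have hSdense : Dense (⋂ j, {x : Fin m → ℂ | l j x ≠ 0}) := by
    refine dense_iInter_of_isOpen (fun j => isOpen_ne_fun (l j).continuous continuous_const) ?_
    intro j x
    rw [mem_closure_iff_seq_limit]
    by_cases hx : l j x = 0
    · refine ⟨fun n => x + ((1 : ℂ) / ((n : ℂ) + 1)) • b j, fun n => ?_, ?_⟩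
      · have : l j (b j) = 1 := by rw [hl]; simp
        simp only [Set.mem_setOf_eq, map_add, map_smul, hx, this, zero_add, smul_eq_mul, mul_one]
        exact one_div_ne_zero (Nat.cast_add_one_ne_zero n)
      · have h1 : Filter.Tendsto (fun n : ℕ => (1 : ℂ) / ((n : ℂ) + 1)) Filter.atTop (nhds 0) :=
          tendsto_one_div_add_atTop_nhds_zero_nat
        simpa using (h1.smul_const (b j)).const_add x
    · exact ⟨fun _ => x, fun _ => hx, tendsto_const_nhds⟩
  let Bc : (Fin m → ℂ) →L[ℂ] (Fin p → ℂ) := LinearMap.toContinuousLinearMap B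
  let f : Fin p → (Fin m → ℂ) → ℂ := fun i x => Bc (fun j => g j x) i
  have hfan : ∀ i, AnalyticOnNhd ℂ (f i) V := by
    intro i x hx
    have h1 : AnalyticAt ℂ (fun x => fun j => g j x) x :=
      AnalyticAt.pi fun j => ((hVsub x hx).2 j).1
    exact (((ContinuousLinearMap.proj (R := ℂ) (φ := fun _ : Fin p => ℂ) i).comp
      Bc).analyticAt _).comp h1
  have hmulc : ∀ i, Continuous fun x : Fin m → ℂ => (A i).mulVec x := fun i =>
    (LinearMap.toContinuousLinearMap (Matrix.toLin' (A i))).continuous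
  have hfeq : ∀ x ∈ V, X x = ∑ i, f i x • (A i).mulVec x := by
    refine eqOn_of_dense hVopen hSdense ?_ ?_ ?_
    · exact (hXan.mono hVU).continuousOn
    · exact continuousOn_finset_sum _ fun i _ =>
        ((hfan i).continuousOn).smul (hmulc i).continuousOn
    · intro x hx hxS
      obtain ⟨c, hc⟩ := hrep x (hVU hx)
      have hgc : (fun j => g j x) = Lam c := by
        funext j
        have h1 := ((hVsub x hx).2 j).2
        have hne : l j x ≠ 0 := Set.mem_iInter.1 hxS j
        rw [hc, hcoord, mul_comm] at h1
        exact (mul_left_cancel₀ hne h1).symm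
      have hfc : ∀ i, f i x = c i := by
        intro i
        change B (fun j => g j x) i = c i
        rw [hgc, hBL]
      simp only [hfc]
      exact hc
  refine ⟨V, hVopen, hVU, hV0, f, hfan, hfeq, ?_, ?_⟩
  · intro g' hg'an hg'eq i
    refine eqOn_of_dense hVopen hAind (hg'an i).continuousOn (hfan i).continuousOn ?_
    intro x hx hxS
    have h0 : ∑ i, (g' i x - f i x) • (A i).mulVec x = 0 := by
      simp only [sub_smul, Finset.sum_sub_distrib]
      rw [← hg'eq x hx, ← hfeq x hx, sub_self]
    exact sub_eq_zero.1 (Fintype.linearIndependent_iff.1 hxS _ h0 i)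
  · intro i k
    refine eqOn_of_dense hVopen hAind ?_ continuousOn_const ?_
    · exact ((hfan i).fderiv.continuousOn).clm_apply (hmulc k).continuousOn
    · intro x hx hxS
      let Ac : Fin p → ((Fin m → ℂ) →L[ℂ] (Fin m → ℂ)) :=
        fun i => LinearMap.toContinuousLinearMap (Matrix.toLin' (A i))
      have hAc : ∀ i x, Ac i x = (A i).mulVec x := fun i x => rfl
      have hD : HasFDerivAt X
          (∑ i, (f i x • Ac i + (fderiv ℂ (f i) x).smulRight ((A i).mulVec x))) x := by
        have h1 : HasFDerivAt (fun x => ∑ i, f i x • (A i).mulVec x)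
            (∑ i, (f i x • Ac i + (fderiv ℂ (f i) x).smulRight ((A i).mulVec x))) x := by
          refine HasFDerivAt.fun_sum fun i _ => ?_
          exact ((hfan i x hx).differentiableAt.hasFDerivAt).smul (Ac i).hasFDerivAt
        refine h1.congr_of_eventuallyEq ?_
        filter_upwards [hVopen.mem_nhds hx] with y hy using hfeq y hy
      have h2 := hcomm k x (hVU hx)
      rw [hD.fderiv, hfeq x hx, Matrix.mulVec_sum] at h2
      have h3 : ∑ i, (fderiv ℂ (f i) x ((A k).mulVec x)) • (A i).mulVec x = 0 := by
        rw [← neg_eq_zero, ← h2]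
        simp only [ContinuousLinearMap.sum_apply, ContinuousLinearMap.add_apply,
          ContinuousLinearMap.smul_apply, ContinuousLinearMap.smulRight_apply, hAc,
          Finset.sum_add_distrib, Matrix.mulVec_smul, Matrix.mulVec_mulVec, hAcomm k]
        abel
      exact Fintype.linearIndependent_iff.1 hxS _ h3 i
end

section
/- (Smooth linearization for systems of type (n,0), fixed point case.) Let X_1, ..., X_n be pairwise commuting smooth vector fields on an open neighborhood U of 0 in ℝ^n such that X_i(0) = 0 for all i, each matrix A_i := DX_i(0) is semisimple, and the vectors A_1 x, ..., A_n x are linearly independent for x in a dense subset of ℝ^n (i.e. 0 is a nondegenerate fixed point). Then there exist nonnegative integers h, e with h + 2e = n, a neighborhood V of 0, a smooth diffeomorphism φ from V onto a neighborhood of 0 with φ(0) = 0, and an invertible real matrix (v_i^j) ∈ GL(n, ℝ), such that the vector fields Y_i := φ_*(Σ_j v_i^j X_j), i.e. Y_i(φ(x)) = Dφ(x)(Σ_j v_i^j X_j(x)), satisfy: Y_i(y) = y_i e_i for i = 1, ..., h; Y_{h+2j−1}(y) = y_{h+2j−1} e_{h+2j−1} + y_{h+2j} e_{h+2j} and Y_{h+2j}(y)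 = y_{h+2j−1} e_{h+2j} − y_{h+2j} e_{h+2j−1} for j = 1, ..., e (e_k the standard basis vectors). -/
open scoped BigOperators

/-- A real square matrix is semisimple iff it is diagonalizable over ℂ. -/
def IsSemisimpleMatrixR {n : ℕ} (A : Matrix (Fin n) (Fin n) ℝ) : Prop :=
  ∃ P : Matrix (Fin n) (Fin n) ℂ, IsUnit P ∧ ∃ d : Fin n → ℂ,
    A.map (algebraMap ℝ ℂ) = P * Matrix.diagonal d * P⁻¹

/-- The model vector fields on ℝⁿ of the normal form with `h` hyperbolic components,
elbolic pairs filling indices `h, ..., m-1`, and constant (regular) vector fields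
`∂/∂x_k` for `k ≥ m` (0-indexed):
`Y i (y) = y_i e_i` for `i < h`;
`Y_{h+2j}(y) = y_{h+2j} e_{h+2j} + y_{h+2j+1} e_{h+2j+1}` and
`Y_{h+2j+1}(y) = y_{h+2j} e_{h+2j+1} - y_{h+2j+1} e_{h+2j}` for the elbolic pairs;
`Y k (y) = e_k` for `m ≤ k`. -/
noncomputable def modelVF (n m h : ℕ) (i : Fin n) (y : Fin n → ℝ) : Fin n → ℝ :=
  if (i : ℕ) < h then Pi.single i (y i)
  else if him : (i : ℕ) < m then
    (if ((i : ℕ) - h) % 2 = 0 then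
      (if hlt : (i : ℕ) + 1 < n then
        Pi.single i (y i) + Pi.single (⟨(i : ℕ) + 1, hlt⟩ : Fin n) (y ⟨(i : ℕ) + 1, hlt⟩)
       else 0)
     else
      (if hpos : 0 < (i : ℕ) then
        Pi.single i (y ⟨(i : ℕ) - 1, by omega⟩) -
          Pi.single (⟨(i : ℕ) - 1, by omega⟩ : Fin n) (y i)
       else 0))
  else Pi.single i 1

section PartA
open scoped ContDiff Topology
open Set Filter

section Nem
set_option linter.unusedSectionVars false
variable {K : Type} [TopologicalSpace K] [CompactSpace K]

noncomputable def nemMul {E F : Type} [NormedAddCommGroup E] [NormedSpace ℝ E]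
    [NormedAddCommGroup F] [NormedSpace ℝ F] :
    C(K, E →L[ℝ] F) →L[ℝ] C(K, E) →L[ℝ] C(K, F) :=
  LinearMap.mkContinuous₂
    (LinearMap.mk₂ ℝ (fun (a : C(K, E →L[ℝ] F)) (u : C(K, E)) =>
        (⟨fun t => a t (u t), by fun_prop⟩ : C(K, F)))
      (by intros; ext; simp) (by intros; ext; simp) (by intros; ext; simp) (by intros; ext; simp))
    1 (by
      intro a u
      rw [ContinuousMap.norm_le _ (by positivity)]
      intro t
      simp only [LinearMap.mk₂_apply, ContinuousMap.coe_mk, one_mul]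
      exact (a t).le_of_opNorm_le_of_le (a.norm_coe_le_norm t) (u.norm_coe_le_norm t))

@[simp] lemma nemMul_apply {E F : Type} [NormedAddCommGroup E] [NormedSpace ℝ E]
    [NormedAddCommGroup F] [NormedSpace ℝ F] (a : C(K, E →L[ℝ] F)) (u : C(K, E)) (t : K) :
    nemMul a u t = a t (u t) := rfl

def nem {E F : Type} [TopologicalSpace E] [TopologicalSpace F] (g : E → F) (hg : Continuous g)
    (u : C(K, E)) : C(K, F) := ⟨fun t => g (u t), hg.comp u.continuous⟩

lemma nem_continuous {E F : Type} [TopologicalSpace E] [TopologicalSpace F] (g : E → F)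
    (hg : Continuous g) : Continuous (nem (K := K) g hg) :=
  ContinuousMap.continuous_postcomp ⟨g, hg⟩

lemma nem_hasFDerivAt {E F : Type} [NormedAddCommGroup E] [NormedSpace ℝ E]
    [NormedAddCommGroup F] [NormedSpace ℝ F] (g : E → F) (hg : ContDiff ℝ 1 g) (u : C(K, E)) :
    HasFDerivAt (nem (K := K) g hg.continuous)
      (nemMul (nem (fderiv ℝ g) (hg.continuous_fderiv one_ne_zero) u)) u := by
  rw [hasFDerivAt_iff_isLittleO, Asymptotics.isLittleO_iff]
  intro ε hε
  have hc := (nem_continuous (K := K) _ (hg.continuous_fderiv one_ne_zero)).continuousAt (x := u)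
  obtain ⟨δ, hδ, hb⟩ := (Metric.continuousAt_iff (α := C(K, E)) (β := C(K, E →L[ℝ] F))).1 hc ε hε
  filter_upwards [Metric.ball_mem_nhds u hδ] with w hw
  rw [ContinuousMap.norm_le _ (by positivity)]
  intro t
  have key : ‖g (w t) - g (u t) - fderiv ℝ g (u t) (w t - u t)‖ ≤ ε * ‖w t - u t‖ := by
    refine Convex.norm_image_sub_le_of_norm_fderiv_le' (s := segment ℝ (u t) (w t)) (𝕜 := ℝ)
      (fun x _ => (hg.differentiable one_ne_zero) x) ?_ (convex_segment _ _)
      (left_mem_segment _ _ _) (right_mem_segment _ _ _)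
    rintro x ⟨a, b, ha, hb', hab, rfl⟩
    have hmem : a • u + b • w ∈ Metric.ball u δ :=
      (convex_ball u δ) (Metric.mem_ball_self hδ) hw ha hb' hab
    have h1 := (ContinuousMap.dist_apply_le_dist (f := nem (K := K) (fderiv ℝ g)
      (hg.continuous_fderiv one_ne_zero) (a • u + b • w)) (g := nem (K := K) (fderiv ℝ g)
      (hg.continuous_fderiv one_ne_zero) u) t).trans (hb hmem).le
    rw [dist_eq_norm] at h1
    exact h1
  exact key.trans (mul_le_mul_of_nonneg_left ((w - u).norm_coe_le_norm t) hε.le)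

lemma nem_contDiff_nat (m : ℕ) : ∀ {E F : Type} [NormedAddCommGroup E] [NormedSpace ℝ E]
    [NormedAddCommGroup F] [NormedSpace ℝ F] (g : E → F) (hg : ContDiff ℝ ∞ g),
    ContDiff ℝ m (nem (K := K) g hg.continuous) := by
  induction m with
  | zero => intro E F _ _ _ _ g hg; exact contDiff_zero.2 (nem_continuous _ _)
  | succ m ih =>
    intro E F _ _ _ _ g hg
    have h1 : ContDiff ℝ 1 g := hg.of_le (by exact_mod_cast le_top)
    have h2 : ContDiff ℝ ∞ (fderiv ℝ g) := hg.fderiv_right (by simp)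
    have := contDiff_succ_iff_hasFDerivAt (𝕜 := ℝ) (n := m) (f := nem (K := K) g hg.continuous)
    push_cast
    rw [this]
    have hM : ContDiff ℝ m (fun a : C(K, E →L[ℝ] F) => nemMul (K := K) (E := E) (F := F) a) :=
      ContinuousLinearMap.contDiff (𝕜 := ℝ) (E := C(K, E →L[ℝ] F)) (F := C(K, E) →L[ℝ] C(K, F))
        (nemMul (K := K) (E := E) (F := F))
    exact ⟨fun u => nemMul (nem (fderiv ℝ g) h2.continuous u),
      hM.comp (ih _ h2), fun u => nem_hasFDerivAt g h1 u⟩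

lemma nem_contDiff {E F : Type} [NormedAddCommGroup E] [NormedSpace ℝ E]
    [NormedAddCommGroup F] [NormedSpace ℝ F] (g : E → F) (hg : ContDiff ℝ ∞ g) :
    ContDiff ℝ ∞ (nem (K := K) g hg.continuous) :=
  contDiff_infty.2 fun m => nem_contDiff_nat m g hg
end Nem

end PartA

section PartB
open scoped ContDiff Topology
open Set Filter

section Had

/-- Inclusion of the extended function. -/
noncomputable def ext01 {H : Type} [TopologicalSpace H] (u : C(unitInterval, H)) (t : ℝ) : H :=
  u (Set.projIcc 0 1 zero_le_one t)

lemma ext01_continuous {H : Type} [TopologicalSpace H] (u : C(unitInterval, H)) :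
    Continuous (ext01 u) := u.continuous.comp continuous_projIcc

lemma ext01_apply {H : Type} [TopologicalSpace H] (u : C(unitInterval, H)) {t : ℝ}
    (ht : t ∈ Icc (0 : ℝ) 1) : ext01 u t = u ⟨t, ht⟩ := by
  simp [ext01, Set.projIcc_of_mem zero_le_one ht]

lemma ext01_hasDeriv {H : Type} [NormedAddCommGroup H] [NormedSpace ℝ H] [CompleteSpace H]
    (u : C(unitInterval, H)) (s : ℝ) :
    HasDerivAt (fun s => ∫ t in (0:ℝ)..s, ext01 u t) (ext01 u s) s :=
  ((ext01_continuous u).integral_hasStrictDerivAt 0 s).hasDerivAt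

noncomputable def primJ {H : Type} [NormedAddCommGroup H] [NormedSpace ℝ H] [CompleteSpace H] :
    C(unitInterval, H) →L[ℝ] C(unitInterval, H) :=
  LinearMap.mkContinuous
    { toFun := fun u => ⟨fun s => ∫ t in (0:ℝ)..(s : ℝ), ext01 u t, by
        have : Continuous (fun s => ∫ t in (0:ℝ)..s, ext01 u t) :=
          continuous_iff_continuousAt.2 fun s => (ext01_hasDeriv u s).continuousAt
        exact this.comp continuous_subtype_val⟩
      map_add' := by
        intro u v
        ext s
        exact intervalIntegral.integral_add ((ext01_continuous u).intervalIntegrable _ _)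
          ((ext01_continuous v).intervalIntegrable _ _)
      map_smul' := by
        intro c u
        ext s
        exact intervalIntegral.integral_smul c _ } 1 (by
    intro u
    rw [ContinuousMap.norm_le _ (by positivity)]
    intro s
    have := intervalIntegral.norm_integral_le_of_norm_le_const (a := 0) (b := s) (f := ext01 u)
      (C := ‖u‖) (fun x _ => u.norm_coe_le_norm _)
    refine this.trans ?_
    rw [sub_zero, abs_of_nonneg s.2.1, mul_comm]
    exact mul_le_mul_of_nonneg_right s.2.2 (norm_nonneg _))

lemma primJ_apply {H : Type} [NormedAddCommGroup H] [NormedSpace ℝ H] [CompleteSpace H]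
    (u : C(unitInterval, H)) (s : unitInterval) :
    primJ u s = ∫ t in (0:ℝ)..(s : ℝ), ext01 u t := rfl

/-- `x ↦ (t ↦ t • x)` -/
noncomputable def rayL {E : Type} [NormedAddCommGroup E] [NormedSpace ℝ E] :
    E →L[ℝ] C(unitInterval, E) :=
  LinearMap.mkContinuous
    { toFun := fun x => ⟨fun s => (s : ℝ) • x, by fun_prop⟩
      map_add' := by intro x y; ext s; simp
      map_smul' := by intro c x; ext s; exact smul_comm _ _ _ } 1 (by
    intro x
    rw [ContinuousMap.norm_le _ (by positivity)]
    intro s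
    simp only [LinearMap.coe_mk, AddHom.coe_mk, ContinuousMap.coe_mk, norm_smul, Real.norm_eq_abs,
      abs_of_nonneg s.2.1]
    exact mul_le_mul_of_nonneg_right s.2.2 (norm_nonneg _))

lemma hadamard {E F : Type} [NormedAddCommGroup E] [NormedSpace ℝ E]
    [NormedAddCommGroup F] [NormedSpace ℝ F] [CompleteSpace F] (g : E → F) (hg : ContDiff ℝ ∞ g)
    (h0 : g 0 = 0) : ∃ B : E → E →L[ℝ] F, ContDiff ℝ ∞ B ∧ (∀ x, g x = B x x) ∧
      B 0 = fderiv ℝ g 0 := by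
  have h2 : ContDiff ℝ ∞ (fderiv ℝ g) := hg.fderiv_right (by simp)
  have hd : Differentiable ℝ g := hg.differentiable (by simp)
  let N : E → C(unitInterval, E →L[ℝ] F) := fun x => nem (fderiv ℝ g) h2.continuous (rayL x)
  have hN : ContDiff ℝ ∞ N := (nem_contDiff _ h2).comp (rayL (E := E)).contDiff
  let ev : C(unitInterval, E →L[ℝ] F) →L[ℝ] (E →L[ℝ] F) := ContinuousMap.evalCLM ℝ 1
  have hB : ∀ x, ev (primJ (N x)) = ∫ t in (0:ℝ)..1, fderiv ℝ g (t • x) := by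
    intro x
    refine intervalIntegral.integral_congr ?_
    intro t ht
    have ht : t ∈ uIcc (0 : ℝ) 1 := ht
    rw [uIcc_of_le zero_le_one] at ht
    simp only [ext01_apply _ ht]
    rfl
  refine ⟨fun x => ev (primJ (N x)), (ev.comp primJ).contDiff.comp hN, ?_, ?_⟩
  · intro x
    have hc : Continuous fun t : ℝ => fderiv ℝ g (t • x) := h2.continuous.comp (by fun_prop)
    beta_reduce
    rw [hB, ContinuousLinearMap.intervalIntegral_apply (hc.intervalIntegrable _ _)]
    have := intervalIntegral.integral_eq_sub_of_hasDerivAt (a := 0) (b := 1)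
      (f := fun t : ℝ => g (t • x)) (f' := fun t => fderiv ℝ g (t • x) x) ?_ ?_
    · rw [this]; simp [h0]
    · intro t _
      have h3 : HasDerivAt (fun t : ℝ => t • x) x t := by
        simpa using (hasDerivAt_id t).smul_const x
      exact (hd (t • x)).hasFDerivAt.comp_hasDerivAt t h3
    · exact (hc.clm_apply continuous_const).intervalIntegrable _ _
  · beta_reduce; rw [hB]; simp

lemma inv_fun {E F : Type} [NormedAddCommGroup E] [NormedSpace ℝ E] [CompleteSpace E]
    [NormedAddCommGroup F] [NormedSpace ℝ F] (f : E → F) (O : Set E) (hO : IsOpen O)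
    (hf : ContDiffOn ℝ ∞ f O) (a : E) (ha : a ∈ O) (f' : E ≃L[ℝ] F)
    (hf' : HasFDerivAt f (f' : E →L[ℝ] F) a) :
    ∃ e : OpenPartialHomeomorph E F, (∀ x, e x = f x) ∧ a ∈ e.source ∧ e.source ⊆ O ∧
      ContDiffOn ℝ ∞ e.symm e.target ∧ ∀ x ∈ e.source, (fderiv ℝ f x).IsInvertible := by
  have hca : ContDiffAt ℝ ∞ f a := hf.contDiffAt (hO.mem_nhds ha)
  let e0 := hca.toOpenPartialHomeomorph f hf' (by simp)
  have hcont : ContinuousOn (fderiv ℝ f) O := hf.continuousOn_fderiv_of_isOpen hO (by simp)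
  let O' : Set E := O ∩ fderiv ℝ f ⁻¹' (Set.range ContinuousLinearEquiv.toContinuousLinearMap)
  have hO' : IsOpen O' := hcont.isOpen_inter_preimage hO ContinuousLinearEquiv.isOpen
  have he0 : ∀ x, e0 x = f x := fun x => rfl
  refine ⟨e0.restrOpen O' hO', fun x => rfl, ?_, ?_, ?_, ?_⟩
  · refine ⟨hca.mem_toOpenPartialHomeomorph_source hf' (by simp), ha, ⟨f', hf'.fderiv.symm⟩⟩
  · exact fun x hx => hx.2.1
  · intro y hy
    have hy' : (e0.restrOpen O' hO').symm y ∈ (e0.restrOpen O' hO').source :=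
      (e0.restrOpen O' hO').map_target hy
    obtain ⟨hO1, g', hg'⟩ := hy'.2
    have hcx := hf.contDiffAt (hO.mem_nhds hO1)
    refine ((e0.restrOpen O' hO').contDiffAt_symm (f₀' := g') hy ?_ hcx).contDiffWithinAt
    rw [hg']
    exact (hcx.differentiableAt (by simp)).hasFDerivAt
  · exact fun x hx => hx.2.2
end Had

end PartB

section PartC
open scoped ContDiff Topology
open Set Filter

section Euler
set_option linter.unusedSectionVars false
variable {E : Type} [NormedAddCommGroup E] [NormedSpace ℝ E] [CompleteSpace E]

noncomputable def pairC : C(unitInterval, ℝ × E) := ⟨fun s => ((s : ℝ), (0 : E)), by fun_prop⟩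

noncomputable def inrC : C(unitInterval, E) →L[ℝ] C(unitInterval, ℝ × E) :=
  (ContinuousLinearMap.inr ℝ ℝ E).compLeftContinuous ℝ unitInterval

lemma inrC_contDiff : ContDiff ℝ ∞ (fun u : C(unitInterval, E) => inrC (E := E) u) :=
  ContinuousLinearMap.contDiff (𝕜 := ℝ) (E := C(unitInterval, E)) (F := C(unitInterval, ℝ × E))
    (inrC (E := E))

lemma inrC_hasFDerivAt (v : C(unitInterval, E)) :
    HasFDerivAt (fun u : C(unitInterval, E) => inrC (E := E) u) (inrC (E := E)) v :=
  ContinuousLinearMap.hasFDerivAt (𝕜 := ℝ) (E := C(unitInterval, E)) (F := C(unitInterval, ℝ × E))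
    (inrC (E := E))

lemma pair_apply (u : C(unitInterval, E)) (s : unitInterval) :
    (pairC + inrC u : C(unitInterval, ℝ × E)) s = ((s : ℝ), u s) := by
  simp [pairC, inrC]

/-- The nonlinear operator whose inverse gives the solutions of the ODE. -/
lemma psi_props (G : ℝ × E → E) (hG : ContDiff ℝ ∞ G) (hG0 : ∀ s, G (s, 0) = 0)
    (hG1 : ∀ s, HasFDerivAt G (0 : ℝ × E →L[ℝ] E) (s, 0)) :
    ∃ e : OpenPartialHomeomorph C(unitInterval, E) C(unitInterval, E),
      (∀ u, e u = u - primJ (nem G hG.continuous (pairC + inrC u))) ∧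
      (0 : C(unitInterval, E)) ∈ e.source ∧ e 0 = 0 ∧
      ContDiffOn ℝ ∞ e.symm e.target ∧
      HasFDerivAt e.symm (ContinuousLinearMap.id ℝ C(unitInterval, E)) 0 := by
  let Ψ : C(unitInterval, E) → C(unitInterval, E) :=
    fun u => u - primJ (nem G hG.continuous (pairC + inrC u))
  have hJ : ContDiff ℝ ∞ (fun u : C(unitInterval, E) => primJ u) :=
    ContinuousLinearMap.contDiff (𝕜 := ℝ) (E := C(unitInterval, E)) (F := C(unitInterval, E)) primJ
  have hpair : ContDiff ℝ ∞ (fun u : C(unitInterval, E) => pairC + inrC u) :=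
    contDiff_const.add inrC_contDiff
  have hΨ : ContDiff ℝ ∞ Ψ :=
    contDiff_id.sub (hJ.comp ((nem_contDiff G hG).comp hpair))
  have hΨ0 : Ψ 0 = 0 := by
    have : nem G hG.continuous (pairC + inrC (0 : C(unitInterval, E))) = 0 := by
      ext s
      change G ((pairC + inrC (0 : C(unitInterval, E)) : C(unitInterval, ℝ × E)) s) = 0
      rw [pair_apply]
      exact hG0 _
    change (0 : C(unitInterval, E)) - primJ (nem G hG.continuous (pairC + inrC (0 : C(unitInterval, E)))) = 0
    rw [this, map_zero, sub_zero]
  have hG' : ContDiff ℝ 1 G := hG.of_le (by exact_mod_cast le_top)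
  have hd : HasFDerivAt Ψ
      ((ContinuousLinearEquiv.refl ℝ C(unitInterval, E) : C(unitInterval, E) ≃L[ℝ] C(unitInterval, E)) :
        C(unitInterval, E) →L[ℝ] C(unitInterval, E)) 0 := by
    have h1 : HasFDerivAt (fun u : C(unitInterval, E) => pairC + inrC u) inrC 0 :=
      (inrC_hasFDerivAt 0).const_add _
    have h2 := (nem_hasFDerivAt G hG' (pairC + inrC (0 : C(unitInterval, E)))).comp
      (0 : C(unitInterval, E)) h1
    have h3 : HasFDerivAt (fun u : C(unitInterval, E) => primJ u) primJ
      (nem G hG.continuous (pairC + inrC (0 : C(unitInterval, E)))) :=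
      ContinuousLinearMap.hasFDerivAt (𝕜 := ℝ) (E := C(unitInterval, E))
        (F := C(unitInterval, E)) primJ
    have h4 := (hasFDerivAt_id (𝕜 := ℝ) (0 : C(unitInterval, E))).sub
      (h3.comp (0 : C(unitInterval, E)) h2)
    refine h4.congr_fderiv ?_
    have h5 : nemMul (nem (fderiv ℝ G) (hG'.continuous_fderiv one_ne_zero)
        (pairC + inrC (0 : C(unitInterval, E)))) = 0 := by
      ext w s
      rw [nemMul_apply]
      change fderiv ℝ G ((pairC + inrC (0 : C(unitInterval, E)) : C(unitInterval, ℝ × E)) s) (w s) = 0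
      rw [pair_apply, ContinuousMap.zero_apply, (hG1 _).fderiv]
      rfl
    rw [h5]
    ext w s
    simp
  obtain ⟨e, he, he0, -, hes, -⟩ := inv_fun Ψ univ isOpen_univ hΨ.contDiffOn 0 (mem_univ _) _ hd
  have he00 : e 0 = 0 := by rw [he, hΨ0]
  have h0t : (0 : C(unitInterval, E)) ∈ e.target := he00 ▸ e.map_source he0
  have hs0 : e.symm 0 = 0 := by
    conv_lhs => rw [← he00]
    exact e.left_inv he0
  refine ⟨e, he, he0, he00, hes, ?_⟩
  refine e.hasFDerivAt_symm (f' := ContinuousLinearEquiv.refl ℝ C(unitInterval, E)) h0t ?_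
  rw [hs0]
  have : (e : C(unitInterval, E) → C(unitInterval, E)) = Ψ := funext he
  rw [this]
  exact hd

lemma euler_lin (X : E → E) (hX : ContDiff ℝ ∞ X) (hX0 : X 0 = 0)
    (hX1 : HasFDerivAt X (ContinuousLinearMap.id ℝ E) 0) :
    ∃ r > 0, ∃ ψ : E → E, ContDiffOn ℝ ∞ ψ (Metric.ball 0 r) ∧ ψ 0 = 0 ∧
      HasFDerivAt ψ (ContinuousLinearMap.id ℝ E) 0 ∧
      ∀ y ∈ Metric.ball (0 : E) r, fderiv ℝ ψ y y = X (ψ y) := by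
  obtain ⟨B1, hB1, hB1e, hB10⟩ := hadamard (fun x => X x - x) (hX.sub contDiff_id) (by simp [hX0])
  have hB1z : B1 0 = 0 := by
    rw [hB10]
    have := (hX1.sub (hasFDerivAt_id (𝕜 := ℝ) (0 : E))).fderiv
    rw [sub_self] at this
    exact this
  obtain ⟨B, hB, hBe, -⟩ := hadamard B1 hB1 hB1z
  have hXB : ∀ x, X x = x + B x x x := by
    intro x
    rw [← hBe, ← hB1e]; simp
  let G : ℝ × E → E := fun z => B (z.1 • z.2) z.2 z.2
  have hc : ContDiff ℝ ∞ (fun z : ℝ × E => B (z.1 • z.2) z.2) :=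
    (hB.comp (contDiff_fst.smul contDiff_snd)).clm_apply contDiff_snd
  have hG : ContDiff ℝ ∞ G := hc.clm_apply contDiff_snd
  have hG0 : ∀ s, G (s, 0) = 0 := by intro s; simp [G]
  have hG1 : ∀ s, HasFDerivAt G (0 : ℝ × E →L[ℝ] E) (s, 0) := by
    intro s
    have h1 := ((hc.differentiable (by simp)) (s, (0 : E))).hasFDerivAt
    have := h1.clm_apply (hasFDerivAt_snd (𝕜 := ℝ) (p := (s, (0 : E))))
    refine this.congr_fderiv ?_
    simp
  obtain ⟨e, he, he0, he00, hes, hed⟩ := psi_props G hG hG0 hG1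
  have h0t : (0 : C(unitInterval, E)) ∈ e.target := he00 ▸ e.map_source he0
  have hs0 : e.symm 0 = 0 := by
    conv_lhs => rw [← he00]
    exact e.left_inv he0
  let cst : E →L[ℝ] C(unitInterval, E) := ContinuousLinearMap.const ℝ unitInterval
  have hcst : ContDiff ℝ ∞ (fun y : E => cst y) :=
    ContinuousLinearMap.contDiff (𝕜 := ℝ) (E := E) (F := C(unitInterval, E)) cst
  have hcstd : HasFDerivAt (fun y : E => cst y) cst 0 :=
    ContinuousLinearMap.hasFDerivAt (𝕜 := ℝ) (E := E) (F := C(unitInterval, E)) cst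
  let ev : C(unitInterval, E) →L[ℝ] E := ContinuousMap.evalCLM ℝ 1
  have hev : ContDiff ℝ ∞ (fun u : C(unitInterval, E) => ev u) :=
    ContinuousLinearMap.contDiff (𝕜 := ℝ) (E := C(unitInterval, E)) (F := E) ev
  have hevd : ∀ u, HasFDerivAt (fun u : C(unitInterval, E) => ev u) ev u := fun u =>
    ContinuousLinearMap.hasFDerivAt (𝕜 := ℝ) (E := C(unitInterval, E)) (F := E) ev
  have hsrc : e.source ∈ 𝓝 (0 : C(unitInterval, E)) := e.open_source.mem_nhds he0
  obtain ⟨ρ, hρ, hρs⟩ := Metric.mem_nhds_iff.1 hsrc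
  have hcst0 : cst 0 = 0 := map_zero cst
  have hct : ContinuousAt (fun y => e.symm (cst y)) 0 := by
    refine ContinuousAt.comp (g := e.symm) ?_ hcst.continuous.continuousAt
    rw [hcst0]
    exact hed.continuousAt
  have hn1 : ∀ᶠ y in 𝓝 (0 : E), cst y ∈ e.target := by
    refine hcst.continuous.continuousAt (e.open_target.mem_nhds ?_)
    rw [hcst0]; exact h0t
  have hn2 : ∀ᶠ y in 𝓝 (0 : E), e.symm (cst y) ∈ Metric.ball 0 ρ := by
    refine hct (Metric.isOpen_ball.mem_nhds ?_)
    beta_reduce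
    rw [hcst0, hs0]; exact Metric.mem_ball_self hρ
  obtain ⟨r, hr, hrb⟩ := Metric.eventually_nhds_iff_ball.1 (hn1.and hn2)
  have hsm : ContDiffOn ℝ ∞ (fun y => ev (e.symm (cst y))) (Metric.ball 0 r) :=
    hev.comp_contDiffOn (hes.comp hcst.contDiffOn fun y hy => (hrb y hy).1)
  refine ⟨r, hr, fun y => ev (e.symm (cst y)), hsm, ?_, ?_, ?_⟩
  · beta_reduce
    rw [hcst0, hs0]; exact map_zero ev
  · have h1 : HasFDerivAt e.symm (ContinuousLinearMap.id ℝ C(unitInterval, E)) (cst 0) := by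
      rw [hcst0]; exact hed
    have := (hevd _).comp (0 : E) (h1.comp (0 : E) hcstd)
    refine this.congr_fderiv ?_
    ext w
    simp [ev, cst]
  · intro y hy
    set ξ := e.symm (cst y) with hξ
    have hξt := (hrb y hy).1
    have hξρ : ‖ξ‖ < ρ := by simpa using (hrb y hy).2
    have heq : ∀ s : unitInterval, ξ s = y + ∫ t in (0:ℝ)..s,
        ext01 (nem G hG.continuous (pairC + inrC ξ)) t := by
      intro s
      have h1 : e ξ = cst y := e.right_inv hξt
      rw [he] at h1
      have h2 := congrArg (fun u : C(unitInterval, E) => u s) h1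
      have h3 : ξ s - primJ (nem G hG.continuous (pairC + inrC ξ)) s = y := h2
      rw [primJ_apply] at h3
      rw [← h3]; simp
    set H := nem G hG.continuous (pairC + inrC ξ) with hH
    have hHt : ∀ t (ht : t ∈ Icc (0 : ℝ) 1), ext01 H t = G (t, ξ ⟨t, ht⟩) := by
      intro t ht
      rw [ext01_apply _ ht]
      change G ((pairC + inrC ξ : C(unitInterval, ℝ × E)) _) = _
      rw [pair_apply]
    have hscale : ∀ s ∈ Icc (0 : ℝ) 1, ev (e.symm (cst (s • y))) =
        s • (y + ∫ t in (0:ℝ)..s, ext01 H t) := by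
      intro s hs
      let η : C(unitInterval, E) := ⟨fun t => s • ξ (⟨s, hs⟩ * t), by fun_prop⟩
      have hηn : ‖η‖ ≤ ‖ξ‖ := by
        rw [ContinuousMap.norm_le _ (norm_nonneg _)]
        intro t
        change ‖s • ξ _‖ ≤ _
        rw [norm_smul, Real.norm_eq_abs, abs_of_nonneg hs.1]
        calc s * ‖ξ (⟨s, hs⟩ * t)‖ ≤ 1 * ‖ξ‖ :=
              mul_le_mul hs.2 (ξ.norm_coe_le_norm _) (norm_nonneg _) zero_le_one
          _ = _ := one_mul _
      have hηs : η ∈ e.source := hρs (by simpa using hηn.trans_lt hξρ)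
      have heη : e η = cst (s • y) := by
        rw [he]
        ext σ
        change s • ξ (⟨s, hs⟩ * σ) - primJ (nem G hG.continuous (pairC + inrC η)) σ = s • y
        rw [primJ_apply, heq]
        have h1 : ∫ t in (0:ℝ)..σ, ext01 (nem G hG.continuous (pairC + inrC η)) t
            = ∫ t in (0:ℝ)..σ, (s ^ 2) • ext01 H (s * t) := by
          refine intervalIntegral.integral_congr ?_
          intro t ht
          rw [uIcc_of_le σ.2.1] at ht
          have ht' : t ∈ Icc (0 : ℝ) 1 := ⟨ht.1, ht.2.trans σ.2.2⟩
          have hst : s * t ∈ Icc (0 : ℝ) 1 :=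
            ⟨mul_nonneg hs.1 ht'.1, mul_le_one₀ hs.2 ht'.1 ht'.2⟩
          beta_reduce
          rw [hHt _ hst, ext01_apply _ ht']
          change G ((pairC + inrC η : C(unitInterval, ℝ × E)) _) = _
          rw [pair_apply]
          change B (t • s • ξ ⟨s * t, hst⟩) (s • ξ ⟨s * t, hst⟩) (s • ξ ⟨s * t, hst⟩) =
            s ^ 2 • B ((s * t) • ξ ⟨s * t, hst⟩) (ξ ⟨s * t, hst⟩) (ξ ⟨s * t, hst⟩)
          rw [smul_smul, mul_comm t s]
          simp only [map_smul, smul_apply, smul_smul, sq]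
        rw [h1, intervalIntegral.integral_smul]
        have h2 := intervalIntegral.smul_integral_comp_mul_left (a := 0) (b := σ) (ext01 H) s
        rw [sq, mul_smul, h2, mul_zero]
        have h3 : ((⟨s, hs⟩ * σ : unitInterval) : ℝ) = s * σ := rfl
        rw [h3, smul_add]
        simp
      have h4 : e.symm (cst (s • y)) = η := by
        rw [← heη]; exact e.left_inv hηs
      rw [h4, ← heq ⟨s, hs⟩]
      change s • ξ (⟨s, hs⟩ * 1) = _
      rw [mul_one]
    have hdψ : DifferentiableAt ℝ (fun y => ev (e.symm (cst y))) ((1 : ℝ) • y) := by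
      rw [one_smul]
      exact (hsm.contDiffAt (Metric.isOpen_ball.mem_nhds hy)).differentiableAt (by simp)
    have hray : HasDerivAt (fun s : ℝ => s • y) y 1 := by
      simpa using (hasDerivAt_id (1 : ℝ)).smul_const y
    have d1 := (hdψ.hasFDerivAt.comp_hasDerivAt (1 : ℝ) hray).hasDerivWithinAt (s := Icc 0 1)
    have d2 : HasDerivAt (fun s : ℝ => s • (y + ∫ t in (0:ℝ)..s, ext01 H t))
      ((1 : ℝ) • ext01 H 1 + (1 : ℝ) • (y + ∫ t in (0:ℝ)..1, ext01 H t)) 1 :=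
      (hasDerivAt_id (1 : ℝ)).smul ((ext01_hasDeriv H 1).const_add y)
    have d3 := (d2.hasDerivWithinAt (s := Icc 0 1)).congr (f₁ := fun s : ℝ => ev (e.symm (cst (s • y))))
      hscale (hscale 1 ⟨zero_le_one, le_rfl⟩)
    have huniq : UniqueDiffWithinAt ℝ (Icc (0 : ℝ) 1) 1 :=
      uniqueDiffOn_Icc zero_lt_one 1 ⟨zero_le_one, le_rfl⟩
    have hfin := huniq.eq_deriv _ d1 d3
    have h1m : (1 : ℝ) ∈ Icc (0 : ℝ) 1 := ⟨zero_le_one, le_rfl⟩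
    rw [one_smul, one_smul, one_smul] at hfin
    rw [hfin]
    have hξ1 : y + ∫ t in (0:ℝ)..1, ext01 H t = ξ 1 := (heq 1).symm
    rw [hξ1, hHt 1 h1m]
    change B ((1 : ℝ) • ξ 1) (ξ 1) (ξ 1) + ξ 1 = X (ξ 1)
    rw [hXB, one_smul, add_comm]
end Euler

end PartC

section PartD
open scoped ContDiff Topology
open Set Filter

section Lin
set_option linter.unusedSectionVars false
variable {E : Type} [NormedAddCommGroup E] [NormedSpace ℝ E]

lemma two_le_infty : (2 : WithTop ℕ∞) ≤ ∞ :=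
  WithTop.coe_le_coe.2 (le_top : (2 : ℕ∞) ≤ ⊤)

lemma homog_linear (Z : E → E) (ρ : ℝ)
    (hd : ∀ y ∈ Metric.ball (0 : E) ρ, DifferentiableAt ℝ Z y) (h0 : Z 0 = 0)
    (hh : ∀ y ∈ Metric.ball (0 : E) ρ, fderiv ℝ Z y y = Z y) :
    ∀ y ∈ Metric.ball (0 : E) ρ, Z y = fderiv ℝ Z 0 y := by
  intro y hy
  have hty : ∀ t ∈ Icc (0 : ℝ) 1, t • y ∈ Metric.ball (0 : E) ρ := by
    intro t ht
    rw [mem_ball_zero_iff] at hy ⊢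
    rw [norm_smul, Real.norm_eq_abs, abs_of_nonneg ht.1]
    exact (mul_le_of_le_one_left (norm_nonneg _) ht.2).trans_lt hy
  have hray : ∀ t : ℝ, HasDerivAt (fun s : ℝ => s • y) y t := by
    intro t
    simpa using (hasDerivAt_id t).smul_const y
  have hZt : ∀ t ∈ Icc (0 : ℝ) 1, HasDerivAt (fun s : ℝ => Z (s • y)) (fderiv ℝ Z (t • y) y) t :=
    fun t ht => (hd _ (hty t ht)).hasFDerivAt.comp_hasDerivAt t (hray t)
  have hq : ∀ t ∈ Ioc (0 : ℝ) 1, HasDerivAt (fun s : ℝ => s⁻¹ • Z (s • y)) 0 t := by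
    intro t ht
    have h1 := (hasDerivAt_inv ht.1.ne').smul (hZt t ⟨ht.1.le, ht.2⟩)
    refine h1.congr_deriv ?_
    have h2 := hh _ (hty t ⟨ht.1.le, ht.2⟩)
    rw [map_smul] at h2
    rw [← h2, smul_smul, ← add_smul]
    have : t⁻¹ + -(t ^ 2)⁻¹ * t = 0 := by
      have := ht.1.ne'
      field_simp
      ring
    rw [this, zero_smul]
  have hconst : ∀ t ∈ Ioc (0 : ℝ) 1, t⁻¹ • Z (t • y) = Z y := by
    intro t ht
    have := constant_of_has_deriv_right_zero (f := fun s : ℝ => s⁻¹ • Z (s • y)) (a := t) (b := 1)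
      (fun x hx => (hq x ⟨ht.1.trans_le hx.1, hx.2⟩).continuousAt.continuousWithinAt)
      (fun x hx => (hq x ⟨ht.1.trans_le hx.1, hx.2.le⟩).hasDerivWithinAt) 1 ⟨ht.2, le_rfl⟩
    simpa using this.symm
  have h0d := hZt 0 ⟨le_rfl, zero_le_one⟩
  rw [zero_smul] at h0d
  have hlim := h0d.tendsto_slope_zero
  simp only [zero_add, zero_smul, h0, sub_zero] at hlim
  have hlim2 := hlim.mono_left (nhdsWithin_mono (0 : ℝ) (fun x (hx : x ∈ Ioi (0 : ℝ)) => ne_of_gt hx))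
  have hev : (fun t : ℝ => t⁻¹ • Z (t • y)) =ᶠ[𝓝[>] 0] fun _ => Z y := by
    filter_upwards [Ioc_mem_nhdsGT (zero_lt_one' ℝ)] with t ht using hconst t ht
  exact tendsto_nhds_unique (tendsto_const_nhds.congr' hev.symm) hlim2

lemma exists_global [FiniteDimensional ℝ E] (U : Set E) (hU : IsOpen U) (h0 : (0 : E) ∈ U) (X : E → E)
    (hX : ContDiffOn ℝ ∞ X U) : ∃ Y : E → E, ContDiff ℝ ∞ Y ∧ Y =ᶠ[𝓝 0] X := by
  obtain ⟨R, hR, hRU⟩ := Metric.isOpen_iff.1 hU 0 h0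
  let f : ContDiffBump (0 : E) := ⟨R / 4, R / 2, by positivity, by linarith⟩
  refine ⟨fun x => f x • X x, ?_, ?_⟩
  · rw [contDiff_iff_contDiffAt]
    intro x
    by_cases hx : x ∈ U
    · exact f.contDiff.contDiffAt.smul (hX.contDiffAt (hU.mem_nhds hx))
    · have hx' : x ∉ tsupport f := by
        rw [f.tsupport_eq]
        intro hc
        exact hx (hRU (Metric.closedBall_subset_ball (by change R / 2 < R; linarith) hc))
      have : (fun x => f x • X x) =ᶠ[𝓝 x] fun _ => 0 := by
        filter_upwards [notMem_tsupport_iff_eventuallyEq.1 hx'] with z hz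
        rw [hz]; simp
      exact contDiffAt_const.congr_of_eventuallyEq this
  · filter_upwards [f.eventuallyEq_one] with z hz
    rw [hz]; simp

lemma lin_all [FiniteDimensional ℝ E] {ι : Type} [Fintype ι] (U : Set E) (hU : IsOpen U) (h0 : (0 : E) ∈ U)
    (X : ι → E → E) (hX : ∀ i, ContDiffOn ℝ ∞ (X i) U)
    (hcomm : ∀ i j, ∀ x ∈ U, fderiv ℝ (X j) x (X i x) - fderiv ℝ (X i) x (X j x) = 0)
    (hfix : ∀ i, X i 0 = 0) (c : ι → ℝ)
    (hc : ∀ v, ∑ j, c j • fderiv ℝ (X j) 0 v = v) :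
    ∃ e : OpenPartialHomeomorph E E, (0 : E) ∈ e.source ∧ e 0 = 0 ∧
      ContDiffOn ℝ ∞ e e.source ∧ ContDiffOn ℝ ∞ e.symm e.target ∧ e.target ⊆ U ∧
      ∀ i, ∀ y ∈ e.source, (fderiv ℝ e y).IsInvertible ∧
        fderiv ℝ e y (fderiv ℝ (X i) 0 y) = X i (e y) := by
  have hcomplete : CompleteSpace E := FiniteDimensional.complete ℝ E
  have hXd : ∀ i, ∀ x ∈ U, DifferentiableAt ℝ (X i) x := fun i x hx =>
    ((hX i).contDiffAt (hU.mem_nhds hx)).differentiableAt (by simp)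
  let XE : E → E := fun x => ∑ j, c j • X j x
  have hXEs : ContDiffOn ℝ ∞ XE U :=
    ContDiffOn.sum fun j _ => contDiffOn_const.smul (hX j)
  have hXEd : ∀ x ∈ U, HasFDerivAt XE (∑ j, c j • fderiv ℝ (X j) x) x := fun x hx =>
    HasFDerivAt.fun_sum fun j _ => (hXd j x hx).hasFDerivAt.const_smul (c j)
  obtain ⟨Y, hY, hYX⟩ := exists_global U hU h0 XE hXEs
  have hY0 : Y 0 = 0 := by rw [hYX.eq_of_nhds]; simp [XE, hfix]
  have hY1 : HasFDerivAt Y (ContinuousLinearMap.id ℝ E) 0 := by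
    refine ((hXEd 0 h0).congr_of_eventuallyEq hYX).congr_fderiv ?_
    ext v
    simpa using hc v
  obtain ⟨r, hr, ψ, hψ, hψ0, hψ1, hψe⟩ := euler_lin Y hY hY0 hY1
  have hnear : ∀ᶠ y in 𝓝 (0 : E), ψ y ∈ U ∧ Y (ψ y) = XE (ψ y) := by
    have h1 : ContinuousAt ψ 0 := hψ1.continuousAt
    have h2 : ∀ᶠ x in 𝓝 (ψ 0), x ∈ U ∧ Y x = XE x := by
      rw [hψ0]; exact Filter.Eventually.and (hU.mem_nhds h0) hYX
    exact h1.eventually h2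
  obtain ⟨r', hr', hr'b⟩ := Metric.eventually_nhds_iff_ball.1 hnear
  have hψ1' : HasFDerivAt ψ ((ContinuousLinearEquiv.refl ℝ E : E ≃L[ℝ] E) : E →L[ℝ] E) 0 := hψ1
  obtain ⟨e0, he0, he00, he0O, he0s, he0i⟩ := inv_fun ψ (Metric.ball 0 r ∩ Metric.ball 0 r')
    (Metric.isOpen_ball.inter Metric.isOpen_ball) (hψ.mono inter_subset_left) 0
    ⟨Metric.mem_ball_self hr, Metric.mem_ball_self hr'⟩ _ hψ1'
  obtain ⟨ρ, hρ, hρb⟩ := Metric.isOpen_iff.1 e0.open_source 0 he00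
  have hs : (e0.restrOpen (Metric.ball 0 ρ) Metric.isOpen_ball).source = Metric.ball 0 ρ := by
    rw [OpenPartialHomeomorph.restrOpen_source]
    exact inter_eq_right.2 hρb
  have hfun : ∀ x, (e0.restrOpen (Metric.ball 0 ρ) Metric.isOpen_ball) x = ψ x := he0
  have hsymm : ∀ x, (e0.restrOpen (Metric.ball 0 ρ) Metric.isOpen_ball).symm x = e0.symm x :=
    fun x => rfl
  have htgt : (e0.restrOpen (Metric.ball 0 ρ) Metric.isOpen_ball).target ⊆ e0.target :=
    fun x hx => hx.1
  generalize e0.restrOpen (Metric.ball 0 ρ) Metric.isOpen_ball = e at *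
  have hef : (e : E → E) = ψ := funext hfun
  have hψU : ∀ y ∈ Metric.ball (0 : E) ρ, ψ y ∈ U := fun y hy =>
    (hr'b y (he0O (hρb hy)).2).1
  have hψat : ∀ y ∈ Metric.ball (0 : E) ρ, ContDiffAt ℝ ∞ ψ y := fun y hy =>
    hψ.contDiffAt (Metric.isOpen_ball.mem_nhds (he0O (hρb hy)).1)
  have hinv : ∀ y ∈ Metric.ball (0 : E) ρ, (fderiv ℝ ψ y).IsInvertible := fun y hy =>
    he0i y (hρb hy)
  have hpE : ∀ y ∈ Metric.ball (0 : E) ρ, VectorField.pullback ℝ ψ XE y = y := by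
    intro y hy
    have h1 := hψe y (he0O (hρb hy)).1
    rw [(hr'b y (he0O (hρb hy)).2).2] at h1
    obtain ⟨L, hL⟩ := hinv y hy
    simp only [VectorField.pullback, ← h1, ← hL]
    simp
  have hZd : ∀ i, ∀ y ∈ Metric.ball (0 : E) ρ,
      HasFDerivAt (fun y => (fderiv ℝ ψ y).inverse) (fderiv ℝ (fun y => (fderiv ℝ ψ y).inverse) y) y ∧
      HasFDerivAt (fun y => X i (ψ y)) ((fderiv ℝ (X i) (ψ y)).comp (fderiv ℝ ψ y)) y := by
    intro i y hy
    constructor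
    · refine DifferentiableAt.hasFDerivAt ?_
      have h1 : ContDiffAt ℝ 1 (fderiv ℝ ψ) y := (hψat y hy).fderiv_right (by
        rw [one_add_one_eq_two]; exact two_le_infty)
      have h2 : ContDiffAt ℝ 1 (ContinuousLinearMap.inverse (R := ℝ) (M := E) (M₂ := E)) (fderiv ℝ ψ y) :=
        (hinv y hy).contDiffAt_map_inverse
      exact (h2.differentiableAt one_ne_zero).comp y (h1.differentiableAt one_ne_zero)
    · exact (hXd i _ (hψU y hy)).hasFDerivAt.comp y
        ((hψat y hy).differentiableAt (by simp)).hasFDerivAt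
  have hZ : ∀ i, ∀ y ∈ Metric.ball (0 : E) ρ,
      VectorField.pullback ℝ ψ (X i) y = fderiv ℝ (X i) 0 y := by
    intro i
    have h0m : (0 : E) ∈ Metric.ball (0 : E) ρ := Metric.mem_ball_self hρ
    have hD0 : fderiv ℝ (VectorField.pullback ℝ ψ (X i)) 0 = fderiv ℝ (X i) 0 := by
      have := ((hZd i 0 h0m).1.clm_apply (hZd i 0 h0m).2).fderiv
      refine this.trans ?_
      rw [hψ0, hψ1.fderiv, hfix]
      ext v
      simp
    rw [← hD0]
    refine homog_linear _ ρ ?_ ?_ ?_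
    · intro y hy
      exact ((hZd i y hy).1.clm_apply (hZd i y hy).2).differentiableAt
    · simp [VectorField.pullback, hψ0, hfix]
    · intro y hy
      have hb := VectorField.pullback_lieBracket (𝕜 := ℝ) (n := ∞) (by simpa using two_le_infty) (f := ψ)
        (V := XE) (W := X i) (x := y) (hψat y hy) (hXEd _ (hψU y hy)).differentiableAt
        (hXd i _ (hψU y hy))
      have hz : VectorField.lieBracket ℝ XE (X i) (ψ y) = 0 := by
        simp only [VectorField.lieBracket]
        rw [(hXEd _ (hψU y hy)).fderiv]
        simp only [XE, map_sum, map_smul, sum_apply, smul_apply]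
        rw [← Finset.sum_sub_distrib]
        refine Finset.sum_eq_zero fun j _ => ?_
        rw [← smul_sub, hcomm j i _ (hψU y hy), smul_zero]
      have hl : VectorField.pullback ℝ ψ (VectorField.lieBracket ℝ XE (X i)) y = 0 := by
        simp [VectorField.pullback, hz]
      rw [hl] at hb
      have hid : VectorField.pullback ℝ ψ XE =ᶠ[𝓝 y] id := by
        filter_upwards [Metric.isOpen_ball.mem_nhds hy] with z hz using hpE z hz
      simp only [VectorField.lieBracket] at hb
      rw [hid.fderiv_eq, hpE y hy, fderiv_id] at hb
      exact sub_eq_zero.1 hb.symm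
  refine ⟨e, ?_, ?_, ?_, ?_, ?_, ?_⟩
  · rw [hs]; exact Metric.mem_ball_self hρ
  · rw [hfun, hψ0]
  · rw [hs, hef]; exact fun y hy => (hψat y hy).contDiffWithinAt
  · exact (he0s.mono htgt).congr fun x _ => hsymm x
  · intro x hx
    have h1 := e.map_target hx
    rw [hs] at h1
    have h2 := hψU _ h1
    rwa [← hfun, e.right_inv hx] at h2
  · intro i y hy
    rw [hs] at hy
    rw [hef]
    refine ⟨hinv y hy, ?_⟩
    rw [← hZ i y hy]
    obtain ⟨L, hL⟩ := hinv y hy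
    simp only [VectorField.pullback, ← hL]
    simp
end Lin

end PartD

section PartF
open scoped ContDiff Topology
open Set Filter

section LA

lemma alg_struct (R : Type) [CommRing R] [Algebra ℝ R] [FiniteDimensional ℝ R] [IsReduced R] :
    ∃ h e : ℕ, Nonempty (R ≃ₐ[ℝ] (Fin h → ℝ) × (Fin e → ℂ)) := by
  classical
  have : IsArtinianRing R := IsArtinianRing.of_finite ℝ R
  have : Finite (MaximalSpectrum R) := inferInstance
  let : Fintype (MaximalSpectrum R) := Fintype.ofFinite _
  let : ∀ I : MaximalSpectrum R, Field (R ⧸ I.asIdeal) := fun I => Ideal.Quotient.field I.asIdeal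
  let e1 : R ≃ₐ[ℝ] ((I : MaximalSpectrum R) → R ⧸ I.asIdeal) :=
    (IsArtinianRing.equivPi R).restrictScalars ℝ
  let p : MaximalSpectrum R → Prop := fun I => Nonempty ((R ⧸ I.asIdeal) ≃ₐ[ℝ] ℝ)
  have hnp : ∀ I, ¬ p I → Nonempty ((R ⧸ I.asIdeal) ≃ₐ[ℝ] ℂ) := by
    intro I hI
    exact (Real.nonempty_algEquiv_or (R ⧸ I.asIdeal)).resolve_left hI
  let e2 : ((I : MaximalSpectrum R) → R ⧸ I.asIdeal) ≃ₐ[ℝ]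
      ((I : {I // p I}) → R ⧸ I.1.asIdeal) × ((I : {I // ¬ p I}) → R ⧸ I.1.asIdeal) :=
    AlgEquiv.ofRingEquiv (f := RingEquiv.piEquivPiSubtypeProd p (fun I => R ⧸ I.asIdeal))
      (fun r => rfl)
  let e3 := AlgEquiv.prodCongr
    (AlgEquiv.piCongrRight (R := ℝ) (fun I : {I // p I} => Classical.choice I.2))
    (AlgEquiv.piCongrRight (R := ℝ) (fun I : {I // ¬ p I} => Classical.choice (hnp I.1 I.2)))
  let e4 := AlgEquiv.prodCongr
    (AlgEquiv.piCongrLeft ℝ (fun _ => ℝ) (Fintype.equivFin {I // p I}))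
    (AlgEquiv.piCongrLeft ℝ (fun _ => ℂ) (Fintype.equivFin {I // ¬ p I}))
  exact ⟨_, _, ⟨((e1.trans e2).trans e3).trans e4⟩⟩

/-- Coordinates on the model algebra. -/
def coordL (n h e : ℕ) (hn : h + 2 * e = n) :
    (Fin n → ℝ) →ₗ[ℝ] (Fin h → ℝ) × (Fin e → ℂ) where
  toFun y := (fun i => y ⟨i, by omega⟩,
    fun j => ⟨y ⟨h + 2 * j, by omega⟩, y ⟨h + 2 * j + 1, by omega⟩⟩)
  map_add' x y := by
    refine Prod.ext (funext fun i => ?_) (funext fun j => Complex.ext ?_ ?_) <;> simp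
  map_smul' c y := by
    refine Prod.ext (funext fun i => ?_) (funext fun j => Complex.ext ?_ ?_) <;> simp

lemma coordL_inj (n h e : ℕ) (hn : h + 2 * e = n) : Function.Injective (coordL n h e hn) := by
  rw [← LinearMap.ker_eq_bot, LinearMap.ker_eq_bot']
  intro y hy
  have h1 := congrArg Prod.fst hy
  have h2 := congrArg Prod.snd hy
  ext k
  by_cases hk : (k : ℕ) < h
  · exact congrFun h1 ⟨k, hk⟩
  · obtain ⟨j, hj | hj⟩ := Nat.even_or_odd' ((k : ℕ) - h)
    · have h3 := congrArg Complex.re (congrFun h2 ⟨j, by omega⟩)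
      have h4 : (⟨h + 2 * j, by omega⟩ : Fin n) = k := Fin.ext (by simp; omega)
      change y ⟨h + 2 * j, by omega⟩ = 0 at h3
      rw [h4] at h3
      exact h3
    · have h3 := congrArg Complex.im (congrFun h2 ⟨j, by omega⟩)
      have h4 : (⟨h + 2 * j + 1, by omega⟩ : Fin n) = k := Fin.ext (by simp; omega)
      change y ⟨h + 2 * j + 1, by omega⟩ = 0 at h3
      rw [h4] at h3
      exact h3

lemma coordL_mul (n h e : ℕ) (hn : h + 2 * e = n) (i : Fin n) (y : Fin n → ℝ) :
    coordL n h e hn (Pi.single i 1) * coordL n h e hn y =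
      coordL n h e hn (modelVF n n h i y) := by
  obtain ⟨i, hi⟩ := i
  refine Prod.ext (funext fun k => ?_) (funext fun j => ?_)
  · obtain ⟨k, hk⟩ := k
    change (Pi.single (⟨i, hi⟩ : Fin n) (1 : ℝ) : Fin n → ℝ) ⟨k, by omega⟩ * y ⟨k, by omega⟩ =
      modelVF n n h ⟨i, hi⟩ y ⟨k, by omega⟩
    simp only [modelVF]
    split_ifs <;> simp only [Pi.add_apply, Pi.sub_apply, Pi.single_apply, Fin.mk.injEq] <;> grind
  · obtain ⟨j, hj⟩ := j
    apply Complex.ext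
    · change (Pi.single (⟨i, hi⟩ : Fin n) (1 : ℝ) : Fin n → ℝ) ⟨h + 2 * j, by omega⟩ * y ⟨h + 2 * j, by omega⟩
        - (Pi.single (⟨i, hi⟩ : Fin n) (1 : ℝ) : Fin n → ℝ) ⟨h + 2 * j + 1, by omega⟩ * y ⟨h + 2 * j + 1, by omega⟩ =
        modelVF n n h ⟨i, hi⟩ y ⟨h + 2 * j, by omega⟩
      simp only [modelVF]
      split_ifs <;> simp only [Pi.add_apply, Pi.sub_apply, Pi.single_apply, Fin.mk.injEq] <;> grind
    · change (Pi.single (⟨i, hi⟩ : Fin n) (1 : ℝ) : Fin n → ℝ) ⟨h + 2 * j, by omega⟩ * y ⟨h + 2 * j + 1, by omega⟩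
        + (Pi.single (⟨i, hi⟩ : Fin n) (1 : ℝ) : Fin n → ℝ) ⟨h + 2 * j + 1, by omega⟩ * y ⟨h + 2 * j, by omega⟩ =
        modelVF n n h ⟨i, hi⟩ y ⟨h + 2 * j + 1, by omega⟩
      simp only [modelVF]
      split_ifs <;> simp only [Pi.add_apply, Pi.sub_apply, Pi.single_apply, Fin.mk.injEq] <;> grind

lemma aeval_conj {n : ℕ} (P Q D : Matrix (Fin n) (Fin n) ℂ) (hQ : Q * P = 1)
    (p : Polynomial ℂ) : Polynomial.aeval (P * D * Q) p * P = P * Polynomial.aeval D p := by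
  induction p using Polynomial.induction_on' with
  | add p q hp hq => simp only [map_add, add_mul, mul_add, hp, hq]
  | monomial k a =>
    have hs : SemiconjBy P D (P * D * Q) := by
      change P * D = P * D * Q * P
      rw [mul_assoc (P * D), hQ, mul_one]
    have hs' : P * D ^ k = (P * D * Q) ^ k * P := hs.pow_right k
    rw [Polynomial.aeval_monomial, Polynomial.aeval_monomial, mul_assoc, ← hs',
      ← mul_assoc, ← mul_assoc, Algebra.commutes]

lemma semisimple_of_diag {n : ℕ} (P : Matrix (Fin n) (Fin n) ℂ) (hP : IsUnit P) (d : Fin n → ℂ) :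
    Module.End.IsSemisimple (Matrix.toLinAlgEquiv' (P * Matrix.diagonal d * P⁻¹)) := by
  classical
  have hdet : IsUnit P.det := (Matrix.isUnit_iff_isUnit_det P).1 hP
  let p : Polynomial ℂ := ∏ μ ∈ Finset.univ.image d, (Polynomial.X - Polynomial.C μ)
  have hp : Squarefree p :=
    (Polynomial.separable_prod_X_sub_C_iff' (f := id).2 (fun x _ y _ h => h)).squarefree
  refine Module.End.isSemisimple_of_squarefree_aeval_eq_zero hp ?_
  have h0 : Polynomial.aeval (Matrix.diagonal d) p = 0 := by
    have h1 : Polynomial.aeval d p = 0 := by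
      ext i
      have := Polynomial.aeval_algHom_apply (Pi.evalAlgHom ℂ (fun _ : Fin n => ℂ) i) d p
      change (Pi.evalAlgHom ℂ (fun _ : Fin n => ℂ) i) (Polynomial.aeval d p) = 0
      rw [← this]
      simp only [p, map_prod, Pi.evalAlgHom_apply]
      refine Finset.prod_eq_zero (Finset.mem_image_of_mem d (Finset.mem_univ i)) ?_
      simp
    have := Polynomial.aeval_algHom_apply (Matrix.diagonalAlgHom (n := Fin n) (α := ℂ) ℂ) d p
    rw [h1, map_zero] at this
    exact this
  have h2 := aeval_conj P P⁻¹ (Matrix.diagonal d) (Matrix.nonsing_inv_mul P hdet) p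
  rw [h0, mul_zero] at h2
  have h3 : Polynomial.aeval (P * Matrix.diagonal d * P⁻¹) p = 0 := by
    have := congrArg (· * P⁻¹) h2
    simpa [mul_assoc, Matrix.mul_nonsing_inv P hdet] using this
  rw [Polynomial.aeval_algHom_apply, h3, map_zero]
end LA

end PartF

section PartG
open scoped ContDiff Topology
open Set Filter

section LB

lemma nil_zero {n : ℕ} (A : Fin n → Matrix (Fin n) (Fin n) ℝ)
    (hcA : ∀ i j, A i * A j = A j * A i) (hss : ∀ i, IsSemisimpleMatrixR (A i))
    (c : Fin n → ℝ) (hnil : IsNilpotent (∑ j, c j • A j)) : ∑ j, c j • A j = 0 := by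
  classical
  let Φ : Matrix (Fin n) (Fin n) ℝ →+* Module.End ℂ (Fin n → ℂ) :=
    (Matrix.toLinAlgEquiv' : Matrix (Fin n) (Fin n) ℂ ≃ₐ[ℂ] _).toRingEquiv.toRingHom.comp
      (algebraMap ℝ ℂ).mapMatrix
  have hΦ : Function.Injective Φ := by
    refine (Matrix.toLinAlgEquiv' : Matrix (Fin n) (Fin n) ℂ ≃ₐ[ℂ] _).injective.comp ?_
    exact Matrix.map_injective (algebraMap ℝ ℂ).injective
  have hΦs : ∀ (r : ℝ) (M : Matrix (Fin n) (Fin n) ℝ), Φ (r • M) = (r : ℂ) • Φ M := by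
    intro r M
    have : (algebraMap ℝ ℂ).mapMatrix (r • M) = (r : ℂ) • (algebraMap ℝ ℂ).mapMatrix M := by
      ext i j
      simp
    change Matrix.toLinAlgEquiv' ((algebraMap ℝ ℂ).mapMatrix (r • M)) = _
    rw [this, map_smul]
    rfl
  have hΦss : ∀ i, (Φ (A i)).IsSemisimple := by
    intro i
    obtain ⟨P, hP, d, hd⟩ := hss i
    have : Φ (A i) = Matrix.toLinAlgEquiv' ((A i).map (algebraMap ℝ ℂ)) := rfl
    rw [this, hd]
    exact semisimple_of_diag P hP d
  have key : ∀ s : Finset (Fin n), (Φ (∑ j ∈ s, c j • A j)).IsSemisimple := by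
    intro s
    induction s using Finset.induction_on with
    | empty =>
      rw [Finset.sum_empty, map_zero]
      exact Module.End.isSemisimple_zero
    | insert a s ha ih =>
      rw [Finset.sum_insert ha, map_add]
      refine Module.End.IsSemisimple.add_of_commute ?_ ?_ ih
      · refine Commute.map ?_ Φ
        refine Commute.sum_right _ _ _ fun j _ => ?_
        exact (Commute.smul_left (show Commute (A a) (A j) from hcA a j) _).smul_right _
      · rw [hΦs]
        exact Module.End.IsSemisimple_smul _ (hΦss a)
  apply hΦ
  rw [map_zero]
  exact Module.End.eq_zero_of_isNilpotent_isSemisimple (hnil.map Φ) (key _)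

lemma lin_alg {n : ℕ} (A : Fin n → Matrix (Fin n) (Fin n) ℝ)
    (hcA : ∀ i j, A i * A j = A j * A i) (hss : ∀ i, IsSemisimpleMatrixR (A i))
    (x0 : Fin n → ℝ) (hli : LinearIndependent ℝ fun i => (A i).mulVec x0) :
    ∃ h e : ℕ, h + 2 * e = n ∧ ∃ Q : (Fin n → ℝ) ≃ₗ[ℝ] (Fin n → ℝ),
      ∃ v : Matrix (Fin n) (Fin n) ℝ, IsUnit v ∧
        (∀ i x, Q (∑ j, v i j • (A j).mulVec x) = modelVF n n h i (Q x)) ∧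
        ∃ c : Fin n → ℝ, ∀ x, ∑ j, c j • (A j).mulVec x = x := by
  classical
  have hspan : ∀ y : Fin n → ℝ, ∃ c : Fin n → ℝ, ∑ j, c j • (A j).mulVec x0 = y := by
    intro y
    have := hli.span_eq_top_of_card_eq_finrank' (by simp)
    have hy : y ∈ Submodule.span ℝ (Set.range fun i => (A i).mulVec x0) := by
      rw [this]; trivial
    exact (Submodule.mem_span_range_iff_exists_fun ℝ).1 hy
  have hmv : ∀ (c : Fin n → ℝ) x, (∑ j, c j • A j).mulVec x = ∑ j, c j • (A j).mulVec x := by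
    intro c x
    rw [Matrix.sum_mulVec]
    simp [Matrix.smul_mulVec]
  let S := Algebra.adjoin ℝ (Set.range A)
  have : IsMulCommutative S := Algebra.isMulCommutative_adjoin ℝ (by
    rintro _ ⟨i, rfl⟩ _ ⟨j, rfl⟩
    exact hcA i j)
  have hAS : ∀ i, A i ∈ S := fun i => Algebra.subset_adjoin ⟨i, rfl⟩
  have hsumS : ∀ c : Fin n → ℝ, ∑ j, c j • A j ∈ S := fun c =>
    Subalgebra.sum_mem _ fun j _ => Subalgebra.smul_mem _ (hAS j) _
  have hSc : ∀ a ∈ S, ∀ b ∈ S, a * b = b * a := by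
    intro a ha b hb
    exact congrArg Subtype.val (mul_comm' (⟨a, ha⟩ : S) ⟨b, hb⟩)
  have hkill : ∀ a ∈ S, a.mulVec x0 = 0 → a = 0 := by
    intro a ha h0
    have : ∀ y, a.mulVec y = 0 := by
      intro y
      obtain ⟨c, rfl⟩ := hspan y
      rw [← hmv, Matrix.mulVec_mulVec, hSc a ha _ (hsumS c), ← Matrix.mulVec_mulVec, h0,
        Matrix.mulVec_zero]
    exact Matrix.ext_of_mulVec_single fun i => by rw [this, Matrix.zero_mulVec]
  have hrep : ∀ a ∈ S, ∃ c : Fin n → ℝ, a = ∑ j, c j • A j := by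
    intro a ha
    obtain ⟨c, hc⟩ := hspan (a.mulVec x0)
    refine ⟨c, sub_eq_zero.1 (hkill _ (S.sub_mem ha (hsumS c)) ?_)⟩
    rw [Matrix.sub_mulVec, hmv, hc, sub_self]
  have : IsReduced S := ⟨by
    rintro ⟨a, ha⟩ hnil
    obtain ⟨c, rfl⟩ := hrep a ha
    exact Subtype.ext (nil_zero A hcA hss c (hnil.map S.val))⟩
  have : FiniteDimensional ℝ S := inferInstanceAs (FiniteDimensional ℝ (Subalgebra.toSubmodule S))
  let _ : CommRing S := { (inferInstance : Ring S) with mul_comm := mul_comm' }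
  obtain ⟨h, e, ⟨F⟩⟩ := alg_struct S
  -- evaluation at x0
  let ev : S →ₗ[ℝ] (Fin n → ℝ) :=
    { toFun := fun a => a.1.mulVec x0
      map_add' := fun a b => Matrix.add_mulVec _ _ _
      map_smul' := fun r a => Matrix.smul_mulVec _ _ _ }
  have hev : Function.Bijective ev := by
    constructor
    · rw [← LinearMap.ker_eq_bot, LinearMap.ker_eq_bot']
      rintro ⟨a, ha⟩ h0
      exact Subtype.ext (hkill a ha h0)
    · intro y
      obtain ⟨c, hc⟩ := hspan y
      exact ⟨⟨_, hsumS c⟩, (hmv c x0).trans hc⟩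
  let Ev := LinearEquiv.ofBijective ev hev
  have hfr : Module.finrank ℝ ((Fin h → ℝ) × (Fin e → ℂ)) = h + 2 * e := by
    rw [Module.finrank_prod, Module.finrank_pi, Module.finrank_pi_fintype]
    simp [mul_comm]
  have hn : h + 2 * e = n := by
    rw [← hfr, ← F.toLinearEquiv.finrank_eq, Ev.finrank_eq]
    simp
  let L : (Fin n → ℝ) ≃ₗ[ℝ] (Fin h → ℝ) × (Fin e → ℂ) :=
    (coordL n h e hn).linearEquivOfInjective (coordL_inj n h e hn) (by rw [hfr, hn]; simp)
  have hLm : ∀ i y, L (Pi.single i 1) * L y = L (modelVF n n h i y) := coordL_mul n h e hn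
  let G : (Fin n → ℝ) ≃ₗ[ℝ] S := L.trans F.toLinearEquiv.symm
  have hG : ∀ i y, G (Pi.single i 1) * G y = G (modelVF n n h i y) := by
    intro i y
    change F.symm _ * F.symm _ = F.symm _
    rw [← map_mul]
    exact congrArg _ (hLm i y)
  obtain ⟨v, hv⟩ : ∃ v : Matrix (Fin n) (Fin n) ℝ, ∀ i,
      (G (Pi.single i 1)).1 = ∑ j, v i j • A j := by
    choose v hv using fun i => hrep (G (Pi.single i 1)).1 (G (Pi.single i 1)).2
    exact ⟨Matrix.of v, hv⟩
  refine ⟨h, e, hn, (G.trans Ev).symm, v, ?_, ?_, ?_⟩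
  · rw [← Matrix.vecMul_injective_iff_isUnit]
    have hGy : ∀ y, (G y).1 = ∑ j, (Matrix.vecMul y v) j • A j := by
      intro y
      have h1 : G y = ∑ i, y i • G (Pi.single i 1) := by
        conv_lhs => rw [pi_eq_sum_univ' y]
        simp
      have h2 : (G y).1 = ∑ i, y i • (G (Pi.single i 1)).1 := by
        rw [h1]; simp
      rw [h2]
      simp only [Matrix.vecMul, dotProduct, Finset.sum_smul]
      rw [Finset.sum_comm]
      refine Finset.sum_congr rfl fun i _ => ?_
      rw [hv i, Finset.smul_sum]
      simp [smul_smul]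
    intro y z hyz
    apply G.injective
    apply Subtype.ext
    rw [hGy, hGy]
    exact Finset.sum_congr rfl fun j _ => by rw [show Matrix.vecMul y v = Matrix.vecMul z v from hyz]
  · intro i x
    rw [LinearEquiv.symm_apply_eq]
    obtain ⟨y, rfl⟩ := (G.trans Ev).surjective x
    rw [LinearEquiv.symm_apply_apply, ← hmv, ← hv i]
    change (G (Pi.single i 1)).1.mulVec ((G y).1.mulVec x0) = (G (modelVF n n h i y)).1.mulVec x0
    rw [← hG, Matrix.mulVec_mulVec]
    rfl
  · obtain ⟨c, hc⟩ := hrep 1 S.one_mem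
    exact ⟨c, fun x => by rw [← hmv, ← hc, Matrix.one_mulVec]⟩
end LB

end PartG

section PartH
open scoped ContDiff Topology
open Set Filter

section FIN

lemma comm_lin {E : Type*} [NormedAddCommGroup E] [NormedSpace ℝ E] (U : Set E) (hU : IsOpen U)
    (h0 : (0 : E) ∈ U) (f g : E → E) (hf : ContDiffOn ℝ ∞ f U) (hg : ContDiffOn ℝ ∞ g U)
    (hf0 : f 0 = 0) (hg0 : g 0 = 0)
    (hc : ∀ x ∈ U, fderiv ℝ g x (f x) - fderiv ℝ f x (g x) = 0) (w : E) :
    fderiv ℝ g 0 (fderiv ℝ f 0 w) = fderiv ℝ f 0 (fderiv ℝ g 0 w) := by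
  have hn : U ∈ 𝓝 (0 : E) := hU.mem_nhds h0
  have df : DifferentiableAt ℝ f 0 := (hf.contDiffAt hn).differentiableAt (by simp)
  have dg : DifferentiableAt ℝ g 0 := (hg.contDiffAt hn).differentiableAt (by simp)
  have ddf : DifferentiableAt ℝ (fderiv ℝ f) 0 :=
    ((hf.contDiffAt hn).fderiv_right (m := 1) (by norm_cast)).differentiableAt (by simp)
  have ddg : DifferentiableAt ℝ (fderiv ℝ g) 0 :=
    ((hg.contDiffAt hn).fderiv_right (m := 1) (by norm_cast)).differentiableAt (by simp)
  have h1 := (ddg.hasFDerivAt.clm_apply df.hasFDerivAt).sub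
    (ddf.hasFDerivAt.clm_apply dg.hasFDerivAt)
  have h2 : HasFDerivAt (fun _ : E => (0 : E)) (0 : E →L[ℝ] E) 0 := hasFDerivAt_const _ _
  have h3 := h1.unique (h2.congr_of_eventuallyEq (by
    filter_upwards [hn] with x hx
    exact hc x hx))
  have h4 := congrArg (fun T : E →L[ℝ] E => T w) h3
  simp [hf0, hg0] at h4
  exact sub_eq_zero.1 h4

end FIN

end PartH

/-- Smooth geometric linearization of integrable systems of type (n,0) at a
nondegenerate fixed point: the commuting vector fields can be simultaneously
linearized by a smooth diffeomorphism, after an invertible constant linear change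
of generators, into the normal form with h hyperbolic and e elbolic components. -/
theorem smooth_linearization_type_n0_fixed_point
    (n : ℕ) (U : Set (Fin n → ℝ)) (hUopen : IsOpen U) (hU0 : (0 : Fin n → ℝ) ∈ U)
    (X : Fin n → (Fin n → ℝ) → (Fin n → ℝ))
    (hXsm : ∀ i, ContDiffOn ℝ (⊤ : ℕ∞) (X i) U)
    (hcomm : ∀ i j, ∀ x ∈ U, fderiv ℝ (X j) x (X i x) - fderiv ℝ (X i) x (X j x) = 0)
    (hfix : ∀ i, X i 0 = 0)
    (A : Fin n → Matrix (Fin n) (Fin n) ℝ)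
    (hA : ∀ i v, (A i).mulVec v = fderiv ℝ (X i) 0 v)
    (hss : ∀ i, IsSemisimpleMatrixR (A i))
    (hAind : Dense {x : Fin n → ℝ | LinearIndependent ℝ fun i => (A i).mulVec x}) :
    ∃ h e : ℕ, h + 2 * e = n ∧
      ∃ V W : Set (Fin n → ℝ), IsOpen V ∧ V ⊆ U ∧ (0 : Fin n → ℝ) ∈ V ∧
        IsOpen W ∧ (0 : Fin n → ℝ) ∈ W ∧
        ∃ φ ψ : (Fin n → ℝ) → (Fin n → ℝ),
          ContDiffOn ℝ (⊤ : ℕ∞) φ V ∧ ContDiffOn ℝ (⊤ : ℕ∞) ψ W ∧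
          Set.MapsTo φ V W ∧ Set.MapsTo ψ W V ∧
          (∀ x ∈ V, ψ (φ x) = x) ∧ (∀ y ∈ W, φ (ψ y) = y) ∧ φ '' V = W ∧ φ 0 = 0 ∧
          ∃ v : Matrix (Fin n) (Fin n) ℝ, IsUnit v ∧
            ∀ i : Fin n, ∀ x ∈ V,
              fderiv ℝ φ x (∑ j, v i j • X j x) = modelVF n n h i (φ x) := by
  have hcA : ∀ i j, A i * A j = A j * A i := by
    intro i j
    refine Matrix.ext_of_mulVec_single fun k => ?_
    rw [← Matrix.mulVec_mulVec, ← Matrix.mulVec_mulVec, hA, hA, hA j (Matrix.mulVec _ _), hA i]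
    exact comm_lin U hUopen hU0 (X j) (X i) (hXsm j) (hXsm i) (hfix j) (hfix i)
      (hcomm j i) _
  obtain ⟨x0, hx0⟩ := hAind.nonempty
  obtain ⟨h, e, hn, Q, v, hv, hQ, c, hc⟩ := lin_alg A hcA hss x0 hx0
  obtain ⟨f, hf0, hf00, hfs, hfsym, hfU, hfX⟩ := lin_all U hUopen hU0 X hXsm hcomm hfix c (by
    intro w
    simp only [← hA]
    exact hc w)
  let QL : (Fin n → ℝ) ≃L[ℝ] (Fin n → ℝ) := Q.toContinuousLinearEquiv
  have hQL : ∀ x, QL x = Q x := fun _ => rfl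
  have h0t : (0 : Fin n → ℝ) ∈ f.target := by
    have := f.map_source hf0
    rwa [hf00] at this
  have hfs0 : f.symm 0 = 0 := by
    have := f.left_inv hf0
    rwa [hf00] at this
  have hmW : Set.MapsTo (fun x => QL (f.symm x)) f.target (QL.symm ⁻¹' f.source) := by
    intro x hx
    change QL.symm (QL (f.symm x)) ∈ f.source
    rw [QL.symm_apply_apply]
    exact f.map_target hx
  have hmV : Set.MapsTo (fun y => f (QL.symm y)) (QL.symm ⁻¹' f.source) f.target :=
    fun y hy => f.map_source hy
  have hr : ∀ y ∈ QL.symm ⁻¹' f.source, QL (f.symm (f (QL.symm y))) = y := by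
    intro y hy
    rw [f.left_inv hy, QL.apply_symm_apply]
  refine ⟨h, e, hn, f.target, QL.symm ⁻¹' f.source, f.open_target, hfU, h0t,
    f.open_source.preimage QL.symm.continuous, ?_, fun x => QL (f.symm x), fun y => f (QL.symm y),
    QL.contDiff.comp_contDiffOn hfsym, hfs.comp QL.symm.contDiff.contDiffOn (fun y hy => hy),
    hmW, hmV, ?_, hr, ?_, ?_, v, hv, ?_⟩
  · change QL.symm 0 ∈ f.source
    rw [map_zero]
    exact hf0
  · intro x hx
    change f (QL.symm (QL (f.symm x))) = x
    rw [QL.symm_apply_apply, f.right_inv hx]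
  · refine Set.Subset.antisymm hmW.image_subset ?_
    intro y hy
    exact ⟨f (QL.symm y), hmV hy, hr y hy⟩
  · change QL (f.symm 0) = 0
    rw [hfs0, map_zero]
  · intro i x hx
    have hy := f.map_target hx
    obtain ⟨T, hT⟩ := (hfX i _ hy).1
    have hd : HasFDerivAt f (T : (Fin n → ℝ) →L[ℝ] (Fin n → ℝ)) (f.symm x) := by
      rw [hT]
      exact ((hfs.contDiffAt (f.open_source.mem_nhds hy)).differentiableAt (by simp)).hasFDerivAt
    have hds := f.hasFDerivAt_symm hx hd
    have hdq : HasFDerivAt (fun x => QL (f.symm x))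
        ((QL : (Fin n → ℝ) →L[ℝ] (Fin n → ℝ)).comp
          (T.symm : (Fin n → ℝ) →L[ℝ] (Fin n → ℝ))) x := QL.hasFDerivAt.comp x hds
    rw [hdq.fderiv]
    have hXj : ∀ j, T.symm (X j x) = (A j).mulVec (f.symm x) := by
      intro j
      have h1 := (hfX j _ hy).2
      rw [f.right_inv hx, ← hT, ← hA] at h1
      rw [← h1]
      exact T.symm_apply_apply _
    change QL (T.symm (∑ j, v i j • X j x)) = modelVF n n h i (QL (f.symm x))
    rw [map_sum]
    simp only [ContinuousLinearEquiv.map_smul, hXj]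
    exact hQ i _
end
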